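/- arXiv:1207.6249 — 4 statements merged into one kernel-verified Lean document; each statement's English description precedes it below -/
import Mathlib

section
/- Let (R,m) be a commutative Noetherian local ring and I, I_1, T ideals with I = I_1 + T. Set r = depth(R/(I_1 ∩ T)) and assume r ≤ depth(R/T). Then for all i < r - 1 the local cohomology modules H_m^i(R/I_1) and H_m^i(R/I) are isomorphic. -/
open MvPolynomial

noncomputable section

/-- The irrelevant (graded maximal) ideal `(x_i : i)` of a polynomial ring. -/
def irrelevantIdeal (K : Type) [Field K] (σ : Type) : Ideal (MvPolynomial σ K) :=
  Ideal.span (Set.range (X : σ → MvPolynomial σ K))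

/-- `depthIdeal m M` is the depth of the module `M` with respect to the ideal `m`:
the supremum of lengths of `M`-regular sequences with entries in `m`. -/
def depthIdeal {R : Type} [CommRing R] (m : Ideal R)
    (M : Type) [AddCommGroup M] [Module R M] : ℕ :=
  sSup {k | ∃ rs : List R, rs.length = k ∧ (∀ r ∈ rs, r ∈ m) ∧
    RingTheory.Sequence.IsRegular M rs}

/-- `I` is a squarefree monomial ideal: generated by squarefree monomials. -/
def IsSqFreeMonomialIdeal {K : Type} [Field K] {σ : Type}
    (I : Ideal (MvPolynomial σ K)) : Prop :=
  ∃ 𝒮 : Set (Finset σ),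
    I = Ideal.span ((fun s : Finset σ => ∏ i ∈ s, (X i : MvPolynomial σ K)) '' 𝒮)

/-- `I` is a squarefree monomial ideal generated in degree `d`. -/
def IsSqFreeMonomialIdealInDegree {K : Type} [Field K] {σ : Type}
    (I : Ideal (MvPolynomial σ K)) (d : ℕ) : Prop :=
  ∃ 𝒮 : Set (Finset σ), (∀ s ∈ 𝒮, s.card = d) ∧
    I = Ideal.span ((fun s : Finset σ => ∏ i ∈ s, (X i : MvPolynomial σ K)) '' 𝒮)

/-- The Alexander dual of a squarefree monomial ideal: the intersection of the prime
ideals `P_M = (x_i : x_i ∣ M)` over the (squarefree) monomials `M` in `I`. -/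
def alexDual {K : Type} [Field K] {σ : Type}
    (I : Ideal (MvPolynomial σ K)) : Ideal (MvPolynomial σ K) :=
  ⨅ (s : Finset σ) (_ : (∏ i ∈ s, (X i : MvPolynomial σ K)) ∈ I),
    Ideal.span ((fun i : σ => (X i : MvPolynomial σ K)) '' ↑s)

/-- The edge ideal of a simple graph. -/
def edgeIdeal (K : Type) [Field K] {σ : Type} (G : SimpleGraph σ) :
    Ideal (MvPolynomial σ K) :=
  Ideal.span {p | ∃ i j : σ, G.Adj i j ∧ p = X i * X j}

/-- A minimal graded free resolution of a (homogeneous) ideal `I` in a polynomial ring: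
an exact sequence `⋯ → F₁ → F₀ → I → 0` of free modules `Fᵢ = ⊕ S(-degᵢ b)`, with
degree-zero (homogeneous) differentials whose matrix entries lie in the irrelevant
maximal ideal (minimality). -/
structure MinimalGradedFreeResolution {K : Type} [Field K] {σ : Type}
    (I : Ideal (MvPolynomial σ K)) where
  ι : ℕ → Type
  finite : ∀ i, Finite (ι i)
  deg : ∀ i, ι i → ℕ
  d : ∀ i, (ι (i + 1) →₀ MvPolynomial σ K) →ₗ[MvPolynomial σ K]
      (ι i →₀ MvPolynomial σ K)
  ε : (ι 0 →₀ MvPolynomial σ K) →ₗ[MvPolynomial σ K] MvPolynomial σ K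
  range_ε : LinearMap.range ε = I
  exact_ε : LinearMap.ker ε = LinearMap.range (d 0)
  exact_d : ∀ i, LinearMap.ker (d i) = LinearMap.range (d (i + 1))
  homog_ε : ∀ b : ι 0, (ε (Finsupp.single b 1)).IsHomogeneous (deg 0 b)
  homog_d : ∀ i, ∀ b : ι (i + 1), ∀ c : ι i,
      (d i (Finsupp.single b 1)) c = 0 ∨
      (deg i c ≤ deg (i + 1) b ∧
        ((d i (Finsupp.single b 1)) c).IsHomogeneous (deg (i + 1) b - deg i c))
  minimal : ∀ i, ∀ b : ι (i + 1), ∀ c : ι i,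
      constantCoeff ((d i (Finsupp.single b 1)) c) = 0

namespace MinimalGradedFreeResolution

variable {K : Type} [Field K] {σ : Type} {I : Ideal (MvPolynomial σ K)}

/-- The graded Betti number `β_{i,j}` read off from a minimal graded free resolution. -/
def betti (R : MinimalGradedFreeResolution I) (i j : ℕ) : ℕ :=
  Nat.card {b : R.ι i // R.deg i b = j}

end MinimalGradedFreeResolution

/-- The graded Betti number `β_{i,j}(I)` (well defined since all minimal graded free
resolutions of `I` have the same Betti numbers). -/
def bettiNumber {K : Type} [Field K] {σ : Type} (I : Ideal (MvPolynomial σ K))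
    (i j : ℕ) : ℕ :=
  sSup {b | ∃ R : MinimalGradedFreeResolution I, R.betti i j = b}

/-- Castelnuovo–Mumford regularity: `reg I = sup { j - i : β_{i,j}(I) ≠ 0 }`. -/
def reg {K : Type} [Field K] {σ : Type} (I : Ideal (MvPolynomial σ K)) : ℕ :=
  sSup {r | ∃ i j : ℕ, bettiNumber I i j ≠ 0 ∧ j = i + r}

/-- The initial degree of a homogeneous ideal: the least degree of a nonzero
homogeneous element. -/
def indeg {K : Type} [Field K] {σ : Type} (I : Ideal (MvPolynomial σ K)) : ℕ :=
  sInf {d | ∃ p ∈ I, p ≠ 0 ∧ MvPolynomial.IsHomogeneous p d}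

/-- `I` has a `d`-linear resolution: it admits a minimal graded free resolution all of
whose Betti numbers are concentrated in `β_{i,i+d}`. -/
def HasLinearResolution {K : Type} [Field K] {σ : Type}
    (I : Ideal (MvPolynomial σ K)) (dd : ℕ) : Prop :=
  ∃ R : MinimalGradedFreeResolution I, ∀ i j : ℕ, R.betti i j ≠ 0 → j = i + dd

end
noncomputable section
namespace Stmt1Aux
open CategoryTheory Limits Opposite
variable {R : Type} [CommRing R]

abbrev G (Y : ModuleCat.{0} R) : ModuleCat.{0} R ⥤ (ModuleCat.{0} R)ᵒᵖ :=
  ((linearYoneda R (ModuleCat.{0} R)).obj Y).rightOp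

lemma homology_zero {X K : ModuleCat.{0} R} (P : ProjectiveResolution X) (n : ℕ)
    (h : Subsingleton (Abelian.Ext X K n)) :
    IsZero ((((G K).mapHomologicalComplex (ComplexShape.down ℕ)).obj P.complex).homology n) := by
  rw [← HomologicalComplex.exactAt_iff_isZero_homology]
  cases n with
  | zero =>
    rw [HomologicalComplex.exactAt_iff' _ 1 0 0 (by simp) (by simp), ← ShortComplex.exact_unop_iff,
      ShortComplex.moduleCat_exact_iff]
    intro (f : P.complex.X 0 ⟶ K) hf
    replace hf : P.complex.d 1 0 ≫ f = 0 := hf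
    have : Subsingleton (X ⟶ K) := Abelian.Ext.addEquiv₀.subsingleton_congr.mp h
    have hf0 : f = 0 := by
      have h1 := P.exact₀.g_desc f hf
      have h2 : P.exact₀.desc f hf = 0 := this.elim (P.exact₀.desc f hf) 0
      rw [← h1, h2, comp_zero]
    exact ⟨0, by rw [map_zero]; exact hf0.symm⟩
  | succ n =>
    rw [HomologicalComplex.exactAt_iff' _ (n+2) (n+1) n (by simp) (by simp), ← ShortComplex.exact_unop_iff,
      ShortComplex.moduleCat_exact_iff]
    intro (f : P.complex.X (n+1) ⟶ K) hf
    replace hf : P.complex.d (n+2) (n+1) ≫ f = 0 := hf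
    obtain ⟨g, hg⟩ := (P.extMk_eq_zero_iff f (n+2) rfl hf n rfl).1 (Subsingleton.elim _ _)
    exact ⟨g, hg⟩

/-- short complex of Hom complexes -/
def homSeq {X : ModuleCat.{0} R} (P : ProjectiveResolution X) (S : ShortComplex (ModuleCat.{0} R)) :
    ShortComplex (HomologicalComplex (ModuleCat.{0} R)ᵒᵖ (ComplexShape.down ℕ)) :=
  ShortComplex.mk
    ((NatTrans.mapHomologicalComplex (NatTrans.rightOp ((linearYoneda R (ModuleCat.{0} R)).map S.g)) _).app P.complex)
    ((NatTrans.mapHomologicalComplex (NatTrans.rightOp ((linearYoneda R (ModuleCat.{0} R)).map S.f)) _).app P.complex)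
    (by
      ext n : 1
      apply Quiver.Hom.unop_inj
      ext (x : P.complex.X n ⟶ S.X₁)
      change (x ≫ S.f) ≫ S.g = 0
      simp)

lemma homSeq_exact {X : ModuleCat.{0} R} (P : ProjectiveResolution X)
    {S : ShortComplex (ModuleCat.{0} R)} (hS : S.ShortExact) : (homSeq P S).ShortExact := by
  apply HomologicalComplex.shortExact_of_degreewise_shortExact
  intro n
  have := hS.mono_f
  have := hS.epi_g
  rw [ShortComplex.shortExact_iff_unop]
  refine { exact := ?_, mono_f := ?_, epi_g := ?_ }
  · rw [ShortComplex.moduleCat_exact_iff]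
    intro (x : P.complex.X n ⟶ S.X₂) hx
    replace hx : x ≫ S.g = 0 := hx
    exact ⟨hS.exact.lift x hx, hS.exact.lift_f x hx⟩
  · rw [ModuleCat.mono_iff_injective]
    intro (x : P.complex.X n ⟶ S.X₁) (y : P.complex.X n ⟶ S.X₁) hxy
    exact (cancel_mono S.f).1 hxy
  · rw [ModuleCat.epi_iff_surjective]
    intro (x : P.complex.X n ⟶ S.X₃)
    exact ⟨Projective.factorThru x S.g, Projective.factorThru_comp x S.g⟩

lemma isIso_ext (X : ModuleCat.{0} R) {S : ShortComplex (ModuleCat.{0} R)} (hS : S.ShortExact)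
    (n : ℕ) (h0 : Subsingleton (Abelian.Ext X S.X₁ n))
    (h1 : Subsingleton (Abelian.Ext X S.X₁ (n + 1))) :
    IsIso (((Ext R (ModuleCat.{0} R) n).obj (op X)).map S.g) := by
  let P := projectiveResolution X
  have hex := homSeq_exact P hS
  have z0 : IsZero ((homSeq P S).X₃.homology n) := homology_zero P n h0
  have z1 : IsZero ((homSeq P S).X₃.homology (n+1)) := homology_zero P (n+1) h1
  have : Mono (HomologicalComplex.homologyMap (homSeq P S).f n) :=
    (hex.homology_exact₁ (n+1) n (by simp)).mono_g (z1.eq_zero_of_src _)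
  have : Epi (HomologicalComplex.homologyMap (homSeq P S).f n) :=
    (hex.homology_exact₂ n).epi_f (z0.eq_zero_of_tgt _)
  have hI : IsIso (HomologicalComplex.homologyMap (homSeq P S).f n) := isIso_of_mono_of_epi _
  have key : IsIso ((NatTrans.leftDerived
      (NatTrans.rightOp ((linearYoneda R (ModuleCat.{0} R)).map S.g)) n).app X) := by
    rw [ProjectiveResolution.leftDerived_app_eq _ P]
    have : IsIso ((HomologicalComplex.homologyFunctor (ModuleCat.{0} R)ᵒᵖ (ComplexShape.down ℕ) n).map
        ((NatTrans.mapHomologicalComplex (NatTrans.rightOp ((linearYoneda R (ModuleCat.{0} R)).map S.g)) _).app P.complex)) := hI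
    infer_instance
  change IsIso ((NatTrans.leftDerived
      (NatTrans.rightOp ((linearYoneda R (ModuleCat.{0} R)).map S.g)) n).app X).unop
  infer_instance

lemma iso_lc (J : Ideal R) {S : ShortComplex (ModuleCat.{0} R)} (hS : S.ShortExact)
    (n : ℕ) (h : ∀ t, Subsingleton (Abelian.Ext (ModuleCat.of R (R ⧸ J ^ t)) S.X₁ n))
    (h1 : ∀ t, Subsingleton (Abelian.Ext (ModuleCat.of R (R ⧸ J ^ t)) S.X₁ (n+1))) :
    Nonempty ((localCohomology J n).obj S.X₂ ≅ (localCohomology J n).obj S.X₃) := by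
  let D := localCohomology.diagram (localCohomology.idealPowersDiagram J) n
  have hD : HasColimit D := localCohomology.hasColimitDiagram.{0,0} _ n
  let e : D ⋙ (evaluation _ _).obj S.X₂ ≅ D ⋙ (evaluation _ _).obj S.X₃ := by
    let φ : D ⋙ (evaluation _ _).obj S.X₂ ⟶ D ⋙ (evaluation _ _).obj S.X₃ :=
      Functor.whiskerLeft D ((evaluation _ _).map S.g)
    have : ∀ t, IsIso (φ.app t) := fun t => isIso_ext _ hS n (h _) (h1 _)
    have : IsIso φ := NatIso.isIso_of_isIso_app φ
    exact asIso φ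
  exact ⟨colimitObjIsoColimitCompEvaluation D S.X₂ ≪≫ HasColimit.isoOfNatIso e ≪≫
    (colimitObjIsoColimitCompEvaluation D S.X₃).symm⟩


lemma exists_seq (M : Type) [AddCommGroup M] [Module R M] (m : Ideal R) (r : ℕ)
    (hr : r ≤ sSup {k | ∃ rs : List R, rs.length = k ∧ (∀ r ∈ rs, r ∈ m) ∧
      RingTheory.Sequence.IsRegular M rs}) (h0 : 0 < r) :
    ∃ rs : List R, r ≤ rs.length ∧ (∀ r ∈ rs, r ∈ m) ∧ RingTheory.Sequence.IsRegular M rs := by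
  set s := {k | ∃ rs : List R, rs.length = k ∧ (∀ r ∈ rs, r ∈ m) ∧
      RingTheory.Sequence.IsRegular M rs} with hs
  have hne : s.Nonempty := by
    by_contra h
    rw [Set.not_nonempty_iff_eq_empty] at h
    rw [h] at hr
    simp at hr; omega
  have hb : BddAbove s := by
    by_contra h
    rw [Nat.sSup_of_not_bddAbove h] at hr
    omega
  obtain ⟨rs, h1, h2, h3⟩ := Nat.sSup_mem hne hb
  exact ⟨rs, h1 ▸ hr, h2, h3⟩

lemma ext_vanish [IsNoetherianRing R] [IsLocalRing R] (M : Type) [AddCommGroup M] [Module R M]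
    [Module.Finite R M] (r : ℕ)
    (hr : r ≤ sSup {k | ∃ rs : List R, rs.length = k ∧ (∀ r ∈ rs, r ∈ IsLocalRing.maximalIdeal R) ∧
      RingTheory.Sequence.IsRegular M rs}) (i : ℕ) (hi : i < r) (t : ℕ) :
    Subsingleton (Abelian.Ext (ModuleCat.of R (R ⧸ (IsLocalRing.maximalIdeal R) ^ t))
      (ModuleCat.of R M) i) := by
  obtain ⟨rs, hl, hm, hreg⟩ := exists_seq M _ r hr (by omega)
  refine ModuleCat.subsingleton_ext_of_exists_isRegular (IsLocalRing.maximalIdeal R) _ ?_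
    (ModuleCat.of R M) ?_ rs hm hreg i (by omega)
  · change Module.support R (R ⧸ (IsLocalRing.maximalIdeal R) ^ t) ⊆ _
    rw [Module.support_eq_zeroLocus, Ideal.annihilator_quotient,
      PrimeSpectrum.zeroLocus_subset_zeroLocus_iff]
    intro x hx
    exact ⟨t, Ideal.pow_mem_pow hx t⟩
  · rw [lt_top_iff_ne_top]
    intro h
    have hn : Nontrivial M := hreg.nontrivial
    have := Submodule.eq_bot_of_le_smul_of_le_jacobson_bot (IsLocalRing.maximalIdeal R)
      (⊤ : Submodule R M) Module.Finite.fg_top h.ge (IsLocalRing.maximalIdeal_le_jacobson _)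
    exact top_ne_bot this

lemma ext_ker (X : ModuleCat.{0} R) {S : ShortComplex (ModuleCat.{0} R)} (hS : S.ShortExact)
    (r : ℕ) (h2 : ∀ i < r, Subsingleton (Abelian.Ext X S.X₂ i))
    (h3 : ∀ i < r, Subsingleton (Abelian.Ext X S.X₃ i)) :
    ∀ i < r, Subsingleton (Abelian.Ext X S.X₁ i) := by
  intro i hi
  have := h2 i hi
  cases i with
  | zero =>
    have : Subsingleton (X ⟶ S.X₂) := Abelian.Ext.addEquiv₀.subsingleton_congr.mp this
    have := hS.mono_f
    refine Abelian.Ext.addEquiv₀.subsingleton_congr.mpr ⟨fun a b => ?_⟩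
    exact (cancel_mono S.f).1 (Subsingleton.elim _ _)
  | succ i =>
    have := h3 i (by omega)
    refine subsingleton_of_forall_eq 0 fun x => ?_
    obtain ⟨y, hy⟩ := Abelian.Ext.covariant_sequence_exact₁ X hS x (Subsingleton.elim _ _) rfl
    rw [← hy, Subsingleton.elim y 0, Abelian.Ext.zero_comp]

lemma main [IsNoetherianRing R] [IsLocalRing R] (I₁ T : Ideal R) (r : ℕ)
    (h2 : ∀ i < r, ∀ t, Subsingleton (Abelian.Ext
      (ModuleCat.of R (R ⧸ (IsLocalRing.maximalIdeal R) ^ t)) (ModuleCat.of R (R ⧸ (I₁ ⊓ T))) i))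
    (h3 : ∀ i < r, ∀ t, Subsingleton (Abelian.Ext
      (ModuleCat.of R (R ⧸ (IsLocalRing.maximalIdeal R) ^ t)) (ModuleCat.of R (R ⧸ T)) i))
    (i : ℕ) (hi : i + 1 < r) : Nonempty
        ((localCohomology (IsLocalRing.maximalIdeal R) i).obj (ModuleCat.of R (R ⧸ I₁)) ≅
         (localCohomology (IsLocalRing.maximalIdeal R) i).obj (ModuleCat.of R (R ⧸ (I₁ + T)))) := by
  -- the kernel `K = T / (I₁ ∩ T)` of `R/(I₁ ∩ T) → R/T`
  let p : (R ⧸ (I₁ ⊓ T)) →ₗ[R] (R ⧸ T) := Submodule.factor inf_le_right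
  let q : (R ⧸ (I₁ ⊓ T)) →ₗ[R] (R ⧸ I₁) := Submodule.factor inf_le_left
  let g : (R ⧸ I₁) →ₗ[R] (R ⧸ (I₁ + T)) := Submodule.factor (le_sup_left : I₁ ≤ I₁ ⊔ T)
  let f : LinearMap.ker p →ₗ[R] (R ⧸ I₁) := q ∘ₗ (LinearMap.ker p).subtype
  have hp : ∀ a : R, p (Submodule.Quotient.mk a) = Submodule.Quotient.mk a := fun a => rfl
  have hq : ∀ a : R, q (Submodule.Quotient.mk a) = Submodule.Quotient.mk a := fun a => rfl
  have hg : ∀ a : R, g (Submodule.Quotient.mk a) = Submodule.Quotient.mk a := fun a => rfl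
  have hfinj : Function.Injective f := by
    rw [← LinearMap.ker_eq_bot, LinearMap.ker_eq_bot']
    rintro ⟨x, hx⟩ hfx
    obtain ⟨a, rfl⟩ := Submodule.Quotient.mk_surjective _ x
    replace hfx : q (Submodule.Quotient.mk a) = 0 := hfx
    rw [LinearMap.mem_ker, hp, Submodule.Quotient.mk_eq_zero] at hx
    rw [hq, Submodule.Quotient.mk_eq_zero] at hfx
    ext
    exact (Submodule.Quotient.mk_eq_zero _).2 ⟨hfx, hx⟩
  have hgsurj : Function.Surjective g := by
    intro y
    obtain ⟨a, rfl⟩ := Submodule.Quotient.mk_surjective _ y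
    exact ⟨Submodule.Quotient.mk a, rfl⟩
  have hex : Function.Exact f g := by
    intro y
    constructor
    · intro hy
      obtain ⟨a, rfl⟩ := Submodule.Quotient.mk_surjective _ y
      rw [hg, Submodule.Quotient.mk_eq_zero] at hy
      obtain ⟨b, hb, c, hc, rfl⟩ := Submodule.mem_sup.1 hy
      refine ⟨⟨Submodule.Quotient.mk c, ?_⟩, ?_⟩
      · rw [LinearMap.mem_ker, hp, Submodule.Quotient.mk_eq_zero]; exact hc
      · change q (Submodule.Quotient.mk c) = _
        rw [hq, eq_comm, Submodule.Quotient.eq]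
        simpa using hb
    · rintro ⟨⟨x, hx⟩, rfl⟩
      obtain ⟨a, rfl⟩ := Submodule.Quotient.mk_surjective _ x
      rw [LinearMap.mem_ker, hp, Submodule.Quotient.mk_eq_zero] at hx
      change g (q (Submodule.Quotient.mk a)) = 0
      rw [hq, hg, Submodule.Quotient.mk_eq_zero]
      exact Submodule.mem_sup_right hx
  have hpsurj : Function.Surjective p := by
    intro y
    obtain ⟨a, rfl⟩ := Submodule.Quotient.mk_surjective _ y
    exact ⟨Submodule.Quotient.mk a, rfl⟩
  let S : ShortComplex (ModuleCat.{0} R) :=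
    ShortComplex.mk (ModuleCat.ofHom f) (ModuleCat.ofHom g) (by
      ext x : 2
      exact (hex _).2 ⟨x, rfl⟩)
  let S' : ShortComplex (ModuleCat.{0} R) :=
    ShortComplex.mk (ModuleCat.ofHom (LinearMap.ker p).subtype) (ModuleCat.ofHom p) (by
      ext x : 2
      exact x.2)
  have hS : S.ShortExact :=
    { exact := (ShortComplex.ShortExact.moduleCat_exact_iff_function_exact S).2 hex
      mono_f := (ModuleCat.mono_iff_injective _).2 hfinj
      epi_g := (ModuleCat.epi_iff_surjective _).2 hgsurj }
  have hS' : S'.ShortExact :=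
    { exact := (ShortComplex.ShortExact.moduleCat_exact_iff_function_exact S').2
        (LinearMap.exact_subtype_ker_map p)
      mono_f := (ModuleCat.mono_iff_injective _).2 (LinearMap.ker p).injective_subtype
      epi_g := (ModuleCat.epi_iff_surjective _).2 hpsurj }
  have hK : ∀ t, ∀ i < r, Subsingleton (Abelian.Ext
      (ModuleCat.of R (R ⧸ (IsLocalRing.maximalIdeal R) ^ t)) S'.X₁ i) := fun t =>
    ext_ker _ hS' r (fun i hi => h2 i hi t) (fun i hi => h3 i hi t)
  exact iso_lc (IsLocalRing.maximalIdeal R) hS i (fun t => hK t i (by omega))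
    (fun t => hK t (i+1) hi)

end Stmt1Aux
end

/-- If `I = I₁ + T` in a Noetherian local ring `(R, 𝔪)` and
`r = depth R/(I₁ ∩ T) ≤ depth R/T`, then `H_𝔪^i(R/I₁) ≅ H_𝔪^i(R/I)` for all `i < r - 1`. -/
theorem stmt1 (R : Type) [CommRing R] [IsNoetherianRing R] [IsLocalRing R]
    (I I₁ T : Ideal R) (hI : I = I₁ + T)
    (r : ℕ) (hr : r = depthIdeal (IsLocalRing.maximalIdeal R) (R ⧸ (I₁ ⊓ T)))
    (hle : r ≤ depthIdeal (IsLocalRing.maximalIdeal R) (R ⧸ T)) :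
    ∀ i : ℕ, i < r - 1 →
      Nonempty
        ((localCohomology (IsLocalRing.maximalIdeal R) i).obj (ModuleCat.of R (R ⧸ I₁)) ≅
         (localCohomology (IsLocalRing.maximalIdeal R) i).obj (ModuleCat.of R (R ⧸ I))) := by
  intro i hi
  subst hI
  exact Stmt1Aux.main I₁ T r (fun j hj t => Stmt1Aux.ext_vanish _ r hr.le j hj t)
    (fun j hj t => Stmt1Aux.ext_vanish _ r hle j hj t) i (by omega)
end

section
/- Let H be an induced subgraph of a finite simple graph G. Then for all i, j, the graded Betti numbers satisfy β_{i,j}(I(H̄)) ≤ β_{i,j}(I(Ḡ)), where Ḡ denotes the complement graph and I(·) the edge ideal. -/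
open MvPolynomial

namespace BettiProof

/-! ### Graded free modules -/

section Graded

set_option linter.unusedSectionVars false

variable {K : Type} [Field K] {σ : Type} {Γ : Type} [AddCommMonoid Γ] [IsCancelAdd Γ]

/-- `v` is homogeneous of degree `e` in the graded free module with basis degrees `deg`. -/
def Hg (w : (σ →₀ ℕ) →+ Γ) {ι : Type} (deg : ι → Γ) (e : Γ)
    (v : ι →₀ MvPolynomial σ K) : Prop :=
  ∀ c m, coeff m (v c) ≠ 0 → w m + deg c = e

open Classical in
/-- Restriction of a polynomial to the monomials satisfying `P`. -/
noncomputable def fp (P : (σ →₀ ℕ) → Prop) (p : MvPolynomial σ K) : MvPolynomial σ K :=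
  ∑ m ∈ p.support.filter P, monomial m (coeff m p)

open Classical in
theorem coeff_fp (P : (σ →₀ ℕ) → Prop) (p : MvPolynomial σ K) (m : σ →₀ ℕ) :
    coeff m (fp P p) = if P m then coeff m p else 0 := by
  unfold fp
  rw [coeff_sum]
  simp only [coeff_monomial]
  rw [Finset.sum_ite_eq']
  simp only [Finset.mem_filter, mem_support_iff]
  by_cases h : P m <;> by_cases h2 : coeff m p = 0 <;> simp [h, h2]

variable (w : (σ →₀ ℕ) →+ Γ) {ι κ : Type} (deg : ι → Γ) (degk : κ → Γ)

/-- The degree `e` component. -/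
noncomputable def pr (e : Γ) (v : ι →₀ MvPolynomial σ K) : ι →₀ MvPolynomial σ K :=
  Finsupp.onFinset v.support (fun c => fp (fun m => w m + deg c = e) (v c)) (by
    intro c hc
    rw [Finsupp.mem_support_iff]
    rintro h
    apply hc
    ext m
    rw [coeff_fp, h]
    simp)

open Classical in
theorem coeff_pr (e : Γ) (v : ι →₀ MvPolynomial σ K) (c : ι) (m : σ →₀ ℕ) :
    coeff m (pr w deg e v c) = if w m + deg c = e then coeff m (v c) else 0 := by
  unfold pr
  rw [Finsupp.onFinset_apply, coeff_fp]

theorem pr_add (e : Γ) (u v : ι →₀ MvPolynomial σ K) :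
    pr w deg e (u + v) = pr w deg e u + pr w deg e v := by
  classical
  ext c m
  simp only [coeff_pr, Finsupp.add_apply, coeff_add]
  split_ifs <;> simp

theorem pr_zero (e : Γ) : pr w deg e (0 : ι →₀ MvPolynomial σ K) = 0 := by
  classical
  ext c m
  simp [coeff_pr]

theorem pr_hg (e : Γ) (v : ι →₀ MvPolynomial σ K) : Hg w deg e (pr w deg e v) := by
  classical
  intro c m h
  rw [coeff_pr] at h
  by_contra h2
  simp [h2] at h

variable {w deg degk}

theorem pr_of_hg {e : Γ} {v : ι →₀ MvPolynomial σ K} (h : Hg w deg e v) :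
    pr w deg e v = v := by
  classical
  ext c m
  rw [coeff_pr]
  split_ifs with h1
  · rfl
  · by_contra h2
    exact h1 (h c m (Ne.symm h2))

theorem pr_of_hg_ne {e e' : Γ} {v : ι →₀ MvPolynomial σ K} (h : Hg w deg e v) (hne : e ≠ e') :
    pr w deg e' v = 0 := by
  classical
  ext c m
  rw [coeff_pr]
  split_ifs with h1
  · by_contra h2
    exact hne ((h c m h2).symm.trans h1)
  · simp

theorem hg_monomial_smul {e : Γ} {v : ι →₀ MvPolynomial σ K} (h : Hg w deg e v)
    (m : σ →₀ ℕ) (r : K) : Hg w deg (w m + e) (monomial m r • v) := by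
  intro c m' h'
  rw [Finsupp.smul_apply, smul_eq_mul, coeff_monomial_mul'] at h'
  split_ifs at h' with hle
  · have := h c (m' - m) (right_ne_zero_of_mul h')
    rw [← this, ← add_assoc, ← map_add, add_tsub_cancel_of_le hle]
  · exact absurd rfl h'

theorem hg_single (b : ι) : Hg w deg (deg b) (Finsupp.single b (1 : MvPolynomial σ K)) := by
  classical
  intro c m h
  rw [Finsupp.single_apply] at h
  split_ifs at h with hb
  · subst hb
    rw [coeff_one] at h
    split_ifs at h with hm
    · subst hm; simp
    · exact absurd rfl h
  · simp at h

theorem hg_add {e : Γ} {u v : ι →₀ MvPolynomial σ K} (hu : Hg w deg e u) (hv : Hg w deg e v) :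
    Hg w deg e (u + v) := by
  intro c m h
  rw [Finsupp.add_apply, coeff_add] at h
  by_cases h1 : coeff m (u c) = 0
  · rw [h1, zero_add] at h
    exact hv c m h
  · exact hu c m h1

theorem ind_mono {P : (ι →₀ MvPolynomial σ K) → Prop} (h0 : P 0)
    (hadd : ∀ u v, P u → P v → P (u + v))
    (hm : ∀ b m r, P ((monomial m r : MvPolynomial σ K) • Finsupp.single b 1)) (v : ι →₀ MvPolynomial σ K) : P v := by
  induction v using Finsupp.induction_linear with
  | zero => exact h0
  | add u v hu hv => exact hadd u v hu hv
  | single b p =>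
    induction p using MvPolynomial.induction_on' with
    | monomial m r =>
      have := hm b m r
      rwa [Finsupp.smul_single, smul_eq_mul, mul_one] at this
    | add p q hp hq => rw [Finsupp.single_add]; exact hadd _ _ hp hq

theorem pr_comm {D : (ι →₀ MvPolynomial σ K) →ₗ[MvPolynomial σ K] (κ →₀ MvPolynomial σ K)}
    (hD : ∀ b, Hg w degk (deg b) (D (Finsupp.single b 1))) (e : Γ)
    (v : ι →₀ MvPolynomial σ K) : D (pr w deg e v) = pr w degk e (D v) := by
  induction v using ind_mono with
  | h0 => simp [pr_zero]
  | hadd u v hu hv => rw [pr_add, map_add, map_add, pr_add, hu, hv]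
  | hm b m r =>
    have h1 : Hg w deg (w m + deg b) (monomial m r • Finsupp.single b (1 : MvPolynomial σ K)) :=
      hg_monomial_smul (hg_single b) m r
    have h2 := hg_monomial_smul (hD b) m r
    rw [← map_smul] at h2
    by_cases he : w m + deg b = e
    · subst he
      rw [pr_of_hg h1, pr_of_hg h2]
    · rw [pr_of_hg_ne h1 he, pr_of_hg_ne h2 he, map_zero]

theorem hg_map {D : (ι →₀ MvPolynomial σ K) →ₗ[MvPolynomial σ K] (κ →₀ MvPolynomial σ K)}
    (hD : ∀ b, Hg w degk (deg b) (D (Finsupp.single b 1))) {e : Γ}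
    {v : ι →₀ MvPolynomial σ K} (h : Hg w deg e v) : Hg w degk e (D v) := by
  rw [← pr_of_hg h, pr_comm hD]
  exact pr_hg _ _ _ _

variable (w deg) in
theorem exists_sum_pr (v : ι →₀ MvPolynomial σ K) :
    ∃ T : Finset Γ, v = ∑ e ∈ T, pr w deg e v := by
  classical
  refine ⟨v.support.biUnion fun c => (v c).support.image fun m => w m + deg c, ?_⟩
  ext c m
  rw [Finsupp.finsetSum_apply, coeff_sum]
  simp only [coeff_pr]
  rw [Finset.sum_ite_eq]
  split_ifs with h
  · rfl
  · by_contra h2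
    apply h
    simp only [Finset.mem_biUnion, Finset.mem_image, Finsupp.mem_support_iff, mem_support_iff]
    exact ⟨c, fun h3 => h2 (by simp [h3]), m, h2, rfl⟩

theorem apply_sum (D : (ι →₀ MvPolynomial σ K) →ₗ[MvPolynomial σ K] (κ →₀ MvPolynomial σ K))
    (v : ι →₀ MvPolynomial σ K) (c : κ) :
    D v c = v.sum fun b p => p * D (Finsupp.single b 1) c := by
  conv_lhs => rw [← Finsupp.sum_single v]
  rw [map_finsuppSum, Finsupp.sum, Finsupp.finsetSum_apply, Finsupp.sum]
  refine Finset.sum_congr rfl fun b _ => ?_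
  have : Finsupp.single b (v b) = v b • Finsupp.single b (1 : MvPolynomial σ K) := by simp
  rw [this, map_smul, Finsupp.smul_apply, smul_eq_mul]

theorem cc_apply [Fintype ι]
    (D : (ι →₀ MvPolynomial σ K) →ₗ[MvPolynomial σ K] (κ →₀ MvPolynomial σ K))
    (v : ι →₀ MvPolynomial σ K) (c : κ) :
    constantCoeff (D v c) =
      ∑ b, constantCoeff (v b) * constantCoeff (D (Finsupp.single b 1) c) := by
  rw [apply_sum, Finsupp.sum_fintype _ _ (by simp), map_sum]
  simp

theorem cc_map
    (D : (ι →₀ MvPolynomial σ K) →ₗ[MvPolynomial σ K] (κ →₀ MvPolynomial σ K))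
    (v : ι →₀ MvPolynomial σ K) (hv : ∀ b, constantCoeff (v b) = 0) (c : κ) :
    constantCoeff (D v c) = 0 := by
  rw [apply_sum, Finsupp.sum, map_sum]
  exact Finset.sum_eq_zero fun b _ => by rw [map_mul, hv, zero_mul]

/-- Graded lifting. -/
theorem lift_graded {ν : Type} {degn : ν → Γ}
    {D : (ι →₀ MvPolynomial σ K) →ₗ[MvPolynomial σ K] (κ →₀ MvPolynomial σ K)}
    (hD : ∀ b, Hg w degk (deg b) (D (Finsupp.single b 1)))
    {A : (ν →₀ MvPolynomial σ K) →ₗ[MvPolynomial σ K] (κ →₀ MvPolynomial σ K)}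
    (hA : ∀ b, Hg w degk (degn b) (A (Finsupp.single b 1)))
    (hr : ∀ v, A v ∈ LinearMap.range D) :
    ∃ f : (ν →₀ MvPolynomial σ K) →ₗ[MvPolynomial σ K] (ι →₀ MvPolynomial σ K),
      (∀ v, D (f v) = A v) ∧ ∀ b, Hg w deg (degn b) (f (Finsupp.single b 1)) := by
  have : ∀ b : ν, ∃ u, D u = A (Finsupp.single b 1) ∧ Hg w deg (degn b) u := by
    intro b
    obtain ⟨u, hu⟩ := hr (Finsupp.single b 1)
    refine ⟨pr w deg (degn b) u, ?_, pr_hg _ _ _ _⟩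
    rw [pr_comm hD, hu, pr_of_hg (hA b)]
  choose u hu1 hu2 using this
  refine ⟨Finsupp.linearCombination _ u, ?_, ?_⟩
  · intro v
    have : D ∘ₗ Finsupp.linearCombination _ u = A := by
      ext1 b
      ext1
      simp [hu1]
    exact LinearMap.congr_fun this v
  · intro b
    simpa using hu2 b

/-- Ungraded lifting. -/
theorem lift_plain {ν : Type}
    {D : (ι →₀ MvPolynomial σ K) →ₗ[MvPolynomial σ K] (κ →₀ MvPolynomial σ K)}
    {A : (ν →₀ MvPolynomial σ K) →ₗ[MvPolynomial σ K] (κ →₀ MvPolynomial σ K)}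
    (hr : ∀ v, A v ∈ LinearMap.range D) :
    ∃ f : (ν →₀ MvPolynomial σ K) →ₗ[MvPolynomial σ K] (ι →₀ MvPolynomial σ K),
      ∀ v, D (f v) = A v := by
  choose u hu using fun b : ν => hr (Finsupp.single b 1)
  refine ⟨Finsupp.linearCombination _ u, ?_⟩
  intro v
  have : D ∘ₗ Finsupp.linearCombination _ u = A := by
    ext1 b
    ext1
    simp [hu]
  exact LinearMap.congr_fun this v

end Graded

/-! ### Uniqueness of Betti numbers -/

/-- A minimal exact complex of `ℕ`-graded free modules, without condition on degree zero part. -/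
structure GC (K : Type) [Field K] (σ : Type) where
  ι : ℕ → Type
  deg : ∀ i, ι i → ℕ
  d : ∀ i, (ι (i + 1) →₀ MvPolynomial σ K) →ₗ[MvPolynomial σ K] (ι i →₀ MvPolynomial σ K)
  hom : ∀ i b, Hg Finsupp.degree (deg i) (deg (i + 1) b) (d i (Finsupp.single b 1))
  exact : ∀ i, LinearMap.ker (d i) = LinearMap.range (d (i + 1))
  min : ∀ i v c, constantCoeff (d (i + 1) v c) = 0

section Unique

variable {K : Type} [Field K] {σ : Type}

/-- The inductive comparison statement. -/
def Cmp (X Y : GC K σ) (i : ℕ) : Prop :=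
  ∃ (f : (X.ι i →₀ MvPolynomial σ K) →ₗ[MvPolynomial σ K] (Y.ι i →₀ MvPolynomial σ K))
    (g : (Y.ι i →₀ MvPolynomial σ K) →ₗ[MvPolynomial σ K] (X.ι i →₀ MvPolynomial σ K))
    (h : (X.ι i →₀ MvPolynomial σ K) →ₗ[MvPolynomial σ K] (X.ι (i + 1) →₀ MvPolynomial σ K)),
    (∀ b, Hg Finsupp.degree (Y.deg i) (X.deg i b) (f (Finsupp.single b 1))) ∧
    (∀ v, f (X.d i v) ∈ LinearMap.range (Y.d i)) ∧
    (∀ v, g (Y.d i v) ∈ LinearMap.range (X.d i)) ∧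
    (∀ v, g (f (X.d i v)) - X.d i v = X.d i (h (X.d i v))) ∧
    (∀ v c, constantCoeff (h (X.d i v) c) = 0) ∧
    (∀ v c, constantCoeff ((g (f v) - v) c) = 0)

theorem GC.dd (X : GC K σ) (i : ℕ) (v) : X.d i (X.d (i + 1) v) = 0 := by
  have : X.d (i + 1) v ∈ LinearMap.ker (X.d i) := by
    rw [X.exact]; exact ⟨v, rfl⟩
  exact this

theorem GC.mem (X : GC K σ) (i : ℕ) (v) (h : X.d i v = 0) :
    v ∈ LinearMap.range (X.d (i + 1)) := by
  rw [← X.exact]; exact h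

theorem cmp_succ (X Y : GC K σ) (i : ℕ) (H : Cmp X Y i) : Cmp X Y (i + 1) := by
  obtain ⟨f, g, h, hf, hfr, hgr, hh, hhm, -⟩ := H
  obtain ⟨f', hf', hf'g⟩ := lift_graded (Y.hom i) (A := f ∘ₗ X.d i)
    (degn := X.deg (i + 1)) (fun b => hg_map hf (X.hom i b)) hfr
  obtain ⟨g', hg'⟩ := lift_plain (A := g ∘ₗ Y.d i) hgr
  simp only [LinearMap.comp_apply] at hf' hg'
  have key : ∀ v, X.d i (g' (f' v) - v - h (X.d i v)) = 0 := by
    intro v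
    rw [map_sub, map_sub, hg', hf', hh, sub_self]
  obtain ⟨h', hh'⟩ := lift_plain (D := X.d (i + 1))
    (A := g' ∘ₗ f' - LinearMap.id - h ∘ₗ X.d i) (fun v => X.mem _ _ (key v))
  simp only [LinearMap.comp_apply, LinearMap.sub_apply, LinearMap.id_apply] at hh'
  refine ⟨f', g', h', hf'g, ?_, ?_, ?_, ?_, ?_⟩
  · intro v
    apply Y.mem
    rw [hf', X.dd, map_zero]
  · intro v
    apply X.mem
    rw [hg', Y.dd, map_zero]
  · intro v
    rw [hh', X.dd, map_zero, sub_zero]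
  · intro v c
    exact cc_map h' _ (fun b => X.min i v b) c
  · intro v c
    have : g' (f' v) - v = X.d (i + 1) (h' v) + h (X.d i v) := by
      rw [hh']; abel
    rw [this, Finsupp.add_apply, map_add, X.min, hhm, add_zero]

theorem cmp_card (X Y : GC K σ) (i j : ℕ) [Finite (X.ι i)] [Finite (Y.ι i)] (H : Cmp X Y i) :
    Nat.card {b : X.ι i // X.deg i b = j} ≤ Nat.card {b : Y.ι i // Y.deg i b = j} := by
  classical
  obtain ⟨f, g, h, hf, -, -, -, -, hm⟩ := H
  have := Fintype.ofFinite (X.ι i)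
  have := Fintype.ofFinite (Y.ι i)
  let A : Matrix {b : Y.ι i // Y.deg i b = j} {b : X.ι i // X.deg i b = j} K :=
    fun c b => constantCoeff (f (Finsupp.single b.1 1) c.1)
  let B : Matrix {b : X.ι i // X.deg i b = j} {b : Y.ι i // Y.deg i b = j} K :=
    fun b c => constantCoeff (g (Finsupp.single c.1 1) b.1)
  have hBA : B * A = 1 := by
    ext b b'
    rw [Matrix.mul_apply, Matrix.one_apply]
    have h1 := hm (Finsupp.single b'.1 1) b.1
    rw [Finsupp.sub_apply, map_sub, sub_eq_zero, cc_apply] at h1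
    have h2 : constantCoeff ((Finsupp.single b'.1 (1 : MvPolynomial σ K)) b.1) =
        if b = b' then (1 : K) else 0 := by
      rw [Finsupp.single_apply]
      by_cases hb : b = b'
      · subst hb; simp
      · rw [if_neg hb, if_neg (fun h => hb (Subtype.ext h.symm)), map_zero]
    rw [← h2, ← h1]
    have h4 := Finset.sum_subtype (F := inferInstance) (Finset.univ.filter fun c => Y.deg i c = j)
      (p := fun c => Y.deg i c = j) (by simp)
      (fun c => constantCoeff (f (Finsupp.single b'.1 1) c) *
        constantCoeff (g (Finsupp.single c 1) b.1))
    have h5 : ∑ c, B b c * A c b' = ∑ c : {c : Y.ι i // Y.deg i c = j},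
        constantCoeff (f (Finsupp.single b'.1 1) c.1) *
          constantCoeff (g (Finsupp.single c.1 1) b.1) :=
      Finset.sum_congr rfl fun c _ => mul_comm _ _
    rw [h5, ← h4]
    apply Finset.sum_subset (Finset.subset_univ _)
    intro c _ hc
    have hc' : Y.deg i c ≠ j := by simpa using hc
    by_contra hne
    apply hc'
    have h6 : coeff 0 (f (Finsupp.single b'.1 1) c) ≠ 0 := left_ne_zero_of_mul hne
    have h7 := hf b'.1 c 0 h6
    rw [map_zero, zero_add] at h7
    rw [h7, b'.2]
  have h3 := Matrix.rank_mul_le_right B A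
  rw [hBA, Matrix.rank_one] at h3
  have := h3.trans (Matrix.rank_le_card_height A)
  simpa [Nat.card_eq_fintype_card] using this

end Unique

/-! ### Existence of multigraded minimal resolutions -/

section Existence

variable {K : Type} [Field K] {σ : Type} {Γ : Type} [AddCommMonoid Γ] [IsCancelAdd Γ]

theorem step_aux {w : (σ →₀ ℕ) →+ Γ} (hw : ∀ m, w m = 0 → m = 0) [Finite σ]
    {ι : Type} [Finite ι] (deg : ι → Γ)
    (N : Submodule (MvPolynomial σ K) (ι →₀ MvPolynomial σ K))
    (hN : ∀ e, ∀ v ∈ N, pr w deg e v ∈ N) :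
    ∃ (κ : Type) (_ : Finite κ) (degk : κ → Γ)
      (D : (κ →₀ MvPolynomial σ K) →ₗ[MvPolynomial σ K] (ι →₀ MvPolynomial σ K)),
      (∀ b, Hg w deg (degk b) (D (Finsupp.single b 1))) ∧ LinearMap.range D = N ∧
      ∀ v, D v = 0 → ∀ c, constantCoeff (v c) = 0 := by
  classical
  let P : ℕ → Prop := fun n => ∃ (κ : Type) (_ : Finite κ) (degk : κ → Γ)
    (u : κ → (ι →₀ MvPolynomial σ K)), Nat.card κ = n ∧ (∀ b, Hg w deg (degk b) (u b)) ∧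
      Submodule.span (MvPolynomial σ K) (Set.range u) = N
  have hP : ∃ n, P n := by
    obtain ⟨S0, hS0⟩ := (IsNoetherian.noetherian N : N.FG)
    choose T hT using fun v : (ι →₀ MvPolynomial σ K) => exists_sum_pr w deg v
    refine ⟨_, (Σ s : {s // s ∈ S0}, {e // e ∈ T s.1}), inferInstance, fun x => x.2.1,
      fun x => pr w deg x.2.1 x.1.1, rfl, fun b => pr_hg _ _ _ _, ?_⟩
    apply le_antisymm
    · rw [Submodule.span_le]
      rintro _ ⟨x, rfl⟩
      apply hN
      rw [← hS0]
      exact Submodule.subset_span x.1.2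
    · rw [← hS0, Submodule.span_le]
      intro s hs
      rw [SetLike.mem_coe, hT s]
      apply Submodule.sum_mem
      intro e he
      exact Submodule.subset_span ⟨⟨⟨s, hs⟩, ⟨e, he⟩⟩, rfl⟩
  obtain ⟨κ, hκ, degk, u, hcard, hu, hspan⟩ := Nat.find_spec hP
  have hD : ∀ b, Hg w deg (degk b)
      (Finsupp.linearCombination (MvPolynomial σ K) u (Finsupp.single b 1)) := by
    intro b
    simpa using hu b
  refine ⟨κ, hκ, degk, Finsupp.linearCombination _ u, hD, ?_, ?_⟩
  · rw [Finsupp.range_linearCombination, hspan]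
  · intro v hv b0
    by_contra hne
    -- pass to the homogeneous component
    set v' := pr w degk (degk b0) v with hv'
    have hv'0 : Finsupp.linearCombination (MvPolynomial σ K) u v' = 0 := by
      rw [hv', pr_comm hD, hv, pr_zero]
    have hb0 : v' b0 = C (constantCoeff (v b0)) := by
      ext m
      rw [hv', coeff_pr, coeff_C]
      by_cases hm : m = 0
      · subst hm
        simp [constantCoeff_eq]
      · rw [if_neg (Ne.symm hm), if_neg]
        intro h
        exact hm (hw m (by simpa using h))
    have hsp : u b0 ∈ Submodule.span (MvPolynomial σ K)
        (Set.range fun b : {b // b ≠ b0} => u b.1) := by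
      have h1 : (C (constantCoeff (v b0)) : MvPolynomial σ K) • u b0 ∈ Submodule.span (MvPolynomial σ K)
          (Set.range fun b : {b // b ≠ b0} => u b.1) := by
        have := Fintype.ofFinite κ
        rw [Finsupp.linearCombination_apply, Finsupp.sum_fintype _ _ (by simp),
          ← Finset.add_sum_erase _ _ (Finset.mem_univ b0), hb0] at hv'0
        rw [eq_neg_of_add_eq_zero_left hv'0]
        apply Submodule.neg_mem
        apply Submodule.sum_mem
        intro b hb
        apply Submodule.smul_mem
        exact Submodule.subset_span ⟨⟨b, Finset.ne_of_mem_erase hb⟩, rfl⟩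
      have h2 := Submodule.smul_mem _ (C (constantCoeff (v b0))⁻¹ : MvPolynomial σ K) h1
      rwa [smul_smul, ← C_mul, inv_mul_cancel₀ hne, C_1, one_smul] at h2
    have hlt : Nat.card {b // b ≠ b0} < Nat.find hP := by
      rw [← hcard]
      exact Finite.card_subtype_lt (x := b0) (by simp)
    apply Nat.find_min hP hlt
    refine ⟨{b // b ≠ b0}, inferInstance, fun b => degk b.1, fun b => u b.1, rfl,
      fun b => hu b.1, ?_⟩
    rw [← hspan]
    apply le_antisymm
    · apply Submodule.span_mono
      rintro _ ⟨b, rfl⟩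
      exact ⟨b.1, rfl⟩
    · rw [Submodule.span_le]
      rintro _ ⟨b, rfl⟩
      by_cases hb : b = b0
      · subst hb; exact hsp
      · exact Submodule.subset_span ⟨⟨b, hb⟩, rfl⟩

/-- A graded free module with a graded submodule. -/
structure St (K : Type) [Field K] {σ : Type} {Γ : Type} [AddCommMonoid Γ] [IsCancelAdd Γ]
    (w : (σ →₀ ℕ) →+ Γ) where
  ι : Type
  fin : Finite ι
  deg : ι → Γ
  N : Submodule (MvPolynomial σ K) (ι →₀ MvPolynomial σ K)
  hN : ∀ e, ∀ v ∈ N, pr w deg e v ∈ N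

/-- One step of the resolution. -/
theorem exists_next {w : (σ →₀ ℕ) →+ Γ} (hw : ∀ m, w m = 0 → m = 0) [Finite σ] (s : St K w) :
    ∃ (t : St K w) (D : (t.ι →₀ MvPolynomial σ K) →ₗ[MvPolynomial σ K]
      (s.ι →₀ MvPolynomial σ K)),
      (∀ b, Hg w s.deg (t.deg b) (D (Finsupp.single b 1))) ∧ LinearMap.range D = s.N ∧
      LinearMap.ker D = t.N ∧ ∀ v ∈ t.N, ∀ c, constantCoeff (v c) = 0 := by
  have := s.fin
  obtain ⟨κ, hκ, degk, D, h1, h2, h3⟩ := step_aux hw s.deg s.N s.hN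
  refine ⟨⟨κ, hκ, degk, LinearMap.ker D, ?_⟩, D, h1, h2, rfl, h3⟩
  intro e v hv
  rw [LinearMap.mem_ker] at hv ⊢
  rw [pr_comm h1, hv, pr_zero]

/-- A graded minimal free resolution of the submodule `N` of a graded free module. -/
structure GR {K : Type} [Field K] {σ : Type} {Γ : Type} [AddCommMonoid Γ] [IsCancelAdd Γ]
    (w : (σ →₀ ℕ) →+ Γ) {ι0 : Type} (deg0 : ι0 → Γ)
    (N : Submodule (MvPolynomial σ K) (ι0 →₀ MvPolynomial σ K)) where
  ι : ℕ → Type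
  fin : ∀ i, Finite (ι i)
  deg : ∀ i, ι i → Γ
  d : ∀ i, (ι (i + 1) →₀ MvPolynomial σ K) →ₗ[MvPolynomial σ K] (ι i →₀ MvPolynomial σ K)
  ε : (ι 0 →₀ MvPolynomial σ K) →ₗ[MvPolynomial σ K] (ι0 →₀ MvPolynomial σ K)
  range_ε : LinearMap.range ε = N
  exact_ε : LinearMap.ker ε = LinearMap.range (d 0)
  exact_d : ∀ i, LinearMap.ker (d i) = LinearMap.range (d (i + 1))
  hom_ε : ∀ b, Hg w deg0 (deg 0 b) (ε (Finsupp.single b 1))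
  hom_d : ∀ i b, Hg w (deg i) (deg (i + 1) b) (d i (Finsupp.single b 1))
  min : ∀ i v c, constantCoeff (d i v c) = 0

theorem exists_GR {w : (σ →₀ ℕ) →+ Γ} (hw : ∀ m, w m = 0 → m = 0) [Finite σ] (s : St K w) :
    Nonempty (GR w s.deg s.N) := by
  choose nx D h1 h2 h3 h4 using fun s : St K w => exists_next hw s
  let st : ℕ → St K w := fun i => Nat.rec s (fun _ t => nx t) i
  refine ⟨{
    ι := fun i => (st (i + 1)).ι
    fin := fun i => (st (i + 1)).fin
    deg := fun i => (st (i + 1)).deg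
    d := fun i => D (st (i + 1))
    ε := D s
    range_ε := h2 s
    exact_ε := (h3 s).trans (h2 _).symm
    exact_d := fun i => (h3 (st (i + 1))).trans (h2 _).symm
    hom_ε := h1 s
    hom_d := fun i => h1 (st (i + 1))
    min := fun i v c => h4 (st i) _ ?_ c }⟩
  rw [show (nx (st i)).N = LinearMap.range (D (st (i + 1))) from (h2 (st (i + 1))).symm]
  exact ⟨v, rfl⟩

end Existence

/-! ### Restriction to a subset of the variables -/

section Restrict

variable {K : Type} [Field K] {σ : Type}

/-- The exponent vector `a` only involves variables in `W`. -/
def InW (W : Set σ) (a : σ →₀ ℕ) : Prop := ∀ k, k ∉ W → a k = 0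

theorem InW.mono {W : Set σ} {a b : σ →₀ ℕ} (h : InW W a) (hle : b ≤ a) : InW W b :=
  fun k hk => Nat.le_zero.mp ((hle k).trans (h k hk).le)

/-- `v` only involves basis vectors with degrees in `W`. -/
def SuppW (W : Set σ) {ι : Type} (deg : ι → σ →₀ ℕ) (v : ι →₀ MvPolynomial σ K) : Prop :=
  ∀ c, ¬ InW W (deg c) → v c = 0

/-- Shorthand for homogeneity in the fine grading. -/
abbrev HgM {ι : Type} (deg : ι → σ →₀ ℕ) (e : σ →₀ ℕ) (v : ι →₀ MvPolynomial σ K) : Prop :=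
  Hg (AddMonoidHom.id (σ →₀ ℕ)) deg e v

variable {W : Set σ} {ι κ ν : Type} {deg : ι → σ →₀ ℕ} {degk : κ → σ →₀ ℕ} {degn : ν → σ →₀ ℕ}

theorem suppW_of_hg {a : σ →₀ ℕ} {v : ι →₀ MvPolynomial σ K} (h : HgM deg a v)
    (ha : InW W a) : SuppW W deg v := by
  intro c hc
  by_contra hne
  obtain ⟨m, hm⟩ := MvPolynomial.ne_zero_iff.mp hne
  apply hc
  apply ha.mono
  rw [← h c m hm]
  exact le_add_self

theorem suppW_map {D : (ι →₀ MvPolynomial σ K) →ₗ[MvPolynomial σ K] (κ →₀ MvPolynomial σ K)}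
    (hD : ∀ b, HgM degk (deg b) (D (Finsupp.single b 1)))
    {v : ι →₀ MvPolynomial σ K} (h : SuppW W deg v) : SuppW W degk (D v) := by
  intro c hc
  rw [apply_sum]
  apply Finset.sum_eq_zero
  intro b _
  by_cases hb : InW W (deg b)
  · simp only [suppW_of_hg (hD b) hb c hc, mul_zero]
  · simp only [h b hb, zero_mul]

theorem exact_hom {D2 : (ι →₀ MvPolynomial σ K) →ₗ[MvPolynomial σ K] (κ →₀ MvPolynomial σ K)}
    {D1 : (κ →₀ MvPolynomial σ K) →ₗ[MvPolynomial σ K] (ν →₀ MvPolynomial σ K)}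
    (h2 : ∀ b, HgM degk (deg b) (D2 (Finsupp.single b 1)))
    (hex : LinearMap.ker D1 = LinearMap.range D2)
    {v : κ →₀ MvPolynomial σ K} {a : σ →₀ ℕ} (hva : HgM degk a v)
    (hv : SuppW W degk v) (hv0 : D1 v = 0) :
    ∃ u, SuppW W deg u ∧ D2 u = v := by
  classical
  set μ := a.filter (fun k => k ∉ W) with hμ
  set α := a.filter (fun k => k ∈ W) with hα
  have hsum : μ + α = a := by
    ext k
    by_cases hk : k ∈ W <;> simp [hμ, hα, hk]
  have hαW : InW W α := by
    intro k hk
    simp [hα, hk]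
  let v' : κ →₀ MvPolynomial σ K := Finsupp.mapRange (fun p => p.divMonomial μ) (by simp) v
  have hvv' : v = (monomial μ (1 : K)) • v' := by
    ext c m
    rw [Finsupp.smul_apply, smul_eq_mul, coeff_monomial_mul', one_mul]
    split_ifs with hle
    · simp only [v', Finsupp.mapRange_apply, coeff_divMonomial, add_tsub_cancel_of_le hle]
    · by_contra hne
      apply hle
      have h1 := hva c m hne
      have h3 : InW W (degk c) := by
        by_contra h4
        rw [hv c h4] at hne
        simp at hne
      intro k
      by_cases hk : k ∈ W
      · simp [hμ, hk]
      · have h5 := DFunLike.congr_fun h1 k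
        simp only [AddMonoidHom.id_apply, Finsupp.add_apply, h3 k hk, add_zero] at h5
        simp [hμ, hk, h5]
  have hv'α : HgM degk α v' := by
    intro c m hm
    simp only [v', Finsupp.mapRange_apply, coeff_divMonomial] at hm
    have h1 := hva c _ hm
    rw [AddMonoidHom.id_apply, ← hsum, add_assoc] at h1
    exact add_left_cancel h1
  have hv'0 : D1 v' = 0 := by
    rw [hvv', map_smul] at hv0
    ext1 c
    have := DFunLike.congr_fun hv0 c
    rw [Finsupp.smul_apply, smul_eq_mul, Finsupp.zero_apply, mul_eq_zero, monomial_eq_zero] at this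
    simpa using this
  have : v' ∈ LinearMap.range D2 := by rw [← hex]; exact hv'0
  obtain ⟨u, hu⟩ := this
  refine ⟨monomial μ (1 : K) • pr (AddMonoidHom.id (σ →₀ ℕ)) deg α u, ?_, ?_⟩
  · intro c hc
    rw [Finsupp.smul_apply, suppW_of_hg (pr_hg _ _ _ _) hαW c hc, smul_zero]
  · rw [map_smul, pr_comm h2, hu, pr_of_hg hv'α, ← hvv']

theorem exact_W {D2 : (ι →₀ MvPolynomial σ K) →ₗ[MvPolynomial σ K] (κ →₀ MvPolynomial σ K)}
    {D1 : (κ →₀ MvPolynomial σ K) →ₗ[MvPolynomial σ K] (ν →₀ MvPolynomial σ K)}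
    (h2 : ∀ b, HgM degk (deg b) (D2 (Finsupp.single b 1)))
    (h1 : ∀ b, HgM degn (degk b) (D1 (Finsupp.single b 1)))
    (hex : LinearMap.ker D1 = LinearMap.range D2)
    {v : κ →₀ MvPolynomial σ K} (hv : SuppW W degk v) (hv0 : D1 v = 0) :
    ∃ u, SuppW W deg u ∧ D2 u = v := by
  have : ∀ a, ∃ u, SuppW W deg u ∧ D2 u = pr (AddMonoidHom.id (σ →₀ ℕ)) degk a v := by
    intro a
    refine exact_hom h2 hex (pr_hg _ _ _ _) ?_ ?_
    · intro c hc
      ext m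
      rw [coeff_pr, hv c hc]
      simp
    · rw [pr_comm h1, hv0, pr_zero]
  choose u hu1 hu2 using this
  obtain ⟨T, hT⟩ := exists_sum_pr (AddMonoidHom.id (σ →₀ ℕ)) degk v
  refine ⟨∑ a ∈ T, u a, ?_, ?_⟩
  · intro c hc
    rw [Finsupp.finsetSum_apply]
    exact Finset.sum_eq_zero fun a _ => hu1 a c hc
  · rw [map_sum]
    exact (Finset.sum_congr rfl fun a _ => hu2 a).trans hT.symm

variable (K W deg) in
/-- Inclusion of the part supported in `W`. -/
noncomputable def incl : ({b : ι // InW W (deg b)} →₀ MvPolynomial σ K) →ₗ[MvPolynomial σ K]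
    (ι →₀ MvPolynomial σ K) :=
  Finsupp.lmapDomain _ _ Subtype.val

variable (K W deg) in
/-- Projection to the part supported in `W`. -/
noncomputable def resW : (ι →₀ MvPolynomial σ K) →ₗ[MvPolynomial σ K]
    ({b : ι // InW W (deg b)} →₀ MvPolynomial σ K) :=
  Finsupp.lsubtypeDomain {b : ι | InW W (deg b)}

theorem resW_apply (v : ι →₀ MvPolynomial σ K) (b : {b : ι // InW W (deg b)}) :
    resW K W deg v b = v b.1 := rfl

theorem incl_apply (v : {b : ι // InW W (deg b)} →₀ MvPolynomial σ K)
    (b : {b : ι // InW W (deg b)}) : incl K W deg v b.1 = v b :=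
  Finsupp.mapDomain_apply Subtype.val_injective _ _

theorem incl_supp (v : {b : ι // InW W (deg b)} →₀ MvPolynomial σ K) :
    SuppW W deg (incl K W deg v) := by
  intro c hc
  apply Finsupp.mapDomain_of_notMem_range
  rintro ⟨b, rfl⟩
  exact hc b.2

theorem incl_single (b : {b : ι // InW W (deg b)}) (p : MvPolynomial σ K) :
    incl K W deg (Finsupp.single b p) = Finsupp.single b.1 p :=
  Finsupp.mapDomain_single

theorem incl_resW {v : ι →₀ MvPolynomial σ K} (hv : SuppW W deg v) :
    incl K W deg (resW K W deg v) = v := by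
  ext1 c
  by_cases hc : InW W (deg c)
  · exact (incl_apply _ ⟨c, hc⟩).trans (resW_apply _ _)
  · rw [incl_supp _ c hc, hv c hc]

theorem resW_incl (v : {b : ι // InW W (deg b)} →₀ MvPolynomial σ K) :
    resW K W deg (incl K W deg v) = v := by
  ext1 b
  rw [resW_apply, incl_apply]

/-- Monomial ideal with exponent set `A`. -/
noncomputable def monI (K : Type) [Field K] {σ : Type} (A : Set (σ →₀ ℕ)) : Ideal (MvPolynomial σ K) :=
  Ideal.span ((fun a => monomial a (1 : K)) '' A)

/-- The submodule of the free module of rank one attached to a monomial ideal. -/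
noncomputable def baseN (K : Type) [Field K] {σ : Type} (A : Set (σ →₀ ℕ)) :
    Submodule (MvPolynomial σ K) (Unit →₀ MvPolynomial σ K) :=
  Submodule.comap (Finsupp.lapply ()) (monI K A)

theorem mem_base {A : Set (σ →₀ ℕ)} (v : Unit →₀ MvPolynomial σ K) :
    v ∈ baseN K A ↔ v () ∈ monI K A := Iff.rfl

theorem pr_base (A : Set (σ →₀ ℕ)) (e : σ →₀ ℕ) (v : Unit →₀ MvPolynomial σ K)
    (hv : v ∈ baseN K A) :
    pr (AddMonoidHom.id (σ →₀ ℕ)) (fun _ => 0) e v ∈ baseN K A := by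
  rw [mem_base] at hv ⊢
  unfold monI at hv ⊢
  rw [mem_ideal_span_monomial_image] at hv ⊢
  intro m hm
  apply hv
  rw [mem_support_iff, coeff_pr] at hm
  rw [mem_support_iff]
  intro h
  rw [h] at hm
  simp at hm

/-- Multigraded minimal free resolutions of a monomial ideal. -/
abbrev GRm (K : Type) [Field K] {σ : Type} (A : Set (σ →₀ ℕ)) :=
  GR (AddMonoidHom.id (σ →₀ ℕ)) (fun _ : Unit => 0) (baseN K A)

theorem degree_w (m : σ →₀ ℕ) : m.degree = Finsupp.weight 1 m := by
  rw [Finsupp.degree_eq_weight_one]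
  rfl

theorem homog_of_hg {a : σ →₀ ℕ} {v : ι →₀ MvPolynomial σ K} (h : HgM deg a v) (c : ι) :
    v c = 0 ∨ ((deg c).degree ≤ a.degree ∧ (v c).IsHomogeneous (a.degree - (deg c).degree)) := by
  by_cases h0 : v c = 0
  · exact Or.inl h0
  right
  have key : ∀ m, coeff m (v c) ≠ 0 → m.degree + (deg c).degree = a.degree := by
    intro m hm
    rw [← map_add]
    exact congrArg _ (h c m hm)
  obtain ⟨m, hm⟩ := MvPolynomial.ne_zero_iff.mp h0
  refine ⟨by have := key m hm; omega, ?_⟩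
  intro m' hm'
  have := key m' hm'
  have h3 : m'.degree = Finsupp.weight 1 m' := degree_w m'
  rw [← h3]
  omega

/-- The restricted resolution. -/
noncomputable def restr {A : Set (σ →₀ ℕ)} (X : GRm K A)
    (W : Set σ) : MinimalGradedFreeResolution (monI K {a ∈ A | InW W a}) where
  ι := fun i => {b : X.ι i // InW W (X.deg i b)}
  finite := fun i => by
    have := X.fin i
    infer_instance
  deg := fun i b => (X.deg i b.1).degree
  d := fun i => resW K W (X.deg i) ∘ₗ X.d i ∘ₗ incl K W (X.deg (i + 1))
  ε := Finsupp.lapply () ∘ₗ X.ε ∘ₗ incl K W (X.deg 0)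
  range_ε := by
    apply le_antisymm
    · rintro _ ⟨v, rfl⟩
      have h1 := apply_sum (X.ε ∘ₗ incl K W (X.deg 0)) v ()
      have h2 : (Finsupp.lapply () ∘ₗ X.ε ∘ₗ incl K W (X.deg 0)) v =
        (X.ε ∘ₗ incl K W (X.deg 0)) v () := rfl
      rw [h2, h1]
      apply Submodule.sum_mem
      intro b _
      apply Ideal.mul_mem_left
      rw [LinearMap.comp_apply, incl_single]
      have h3 : X.ε (Finsupp.single b.1 1) ∈ baseN K A := by
        exact X.range_ε.le ⟨_, rfl⟩
      rw [mem_base] at h3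
      unfold monI at h3 ⊢
      rw [mem_ideal_span_monomial_image] at h3 ⊢
      intro m hm
      obtain ⟨s, hs, hsm⟩ := h3 m hm
      refine ⟨s, ⟨hs, ?_⟩, hsm⟩
      apply InW.mono b.2
      have h4 : m + 0 = _ := X.hom_ε b.1 () m (mem_support_iff.mp hm)
      rw [← h4, add_zero]
      exact hsm
    · unfold monI
      rw [Ideal.span_le]
      rintro _ ⟨a, ⟨haA, haW⟩, rfl⟩
      have h1 : (Finsupp.single () (monomial a (1 : K)) : Unit →₀ MvPolynomial σ K) ∈
          baseN K A := by
        rw [mem_base, Finsupp.single_eq_same]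
        exact Ideal.subset_span ⟨a, haA, rfl⟩
      rw [← X.range_ε] at h1
      obtain ⟨u, hu⟩ := h1
      have h2 : HgM (fun _ : Unit => 0) a
          (Finsupp.single () (monomial a (1 : K)) : Unit →₀ MvPolynomial σ K) := by
        intro c m hm
        classical
        rw [Finsupp.single_eq_same, coeff_monomial] at hm
        have : a = m := by
          by_contra h
          simp [h] at hm
        rw [this]
        exact add_zero _
      have h3 := pr_comm X.hom_ε a u
      rw [hu, pr_of_hg h2] at h3
      refine ⟨resW K W (X.deg 0) (pr (AddMonoidHom.id (σ →₀ ℕ)) (X.deg 0) a u), ?_⟩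
      rw [LinearMap.comp_apply, LinearMap.comp_apply,
        incl_resW (suppW_of_hg (pr_hg _ _ _ _) haW), h3]
      simp
  exact_ε := by
    ext v
    rw [LinearMap.mem_ker, LinearMap.mem_range]
    have h0 : (Finsupp.lapply () ∘ₗ X.ε ∘ₗ incl K W (X.deg 0)) v = 0 ↔
        X.ε (incl K W (X.deg 0) v) = 0 := by
      constructor
      · intro h
        ext1
        exact h
      · intro h
        rw [LinearMap.comp_apply, LinearMap.comp_apply, h, map_zero]
    rw [h0]
    constructor
    · intro h
      obtain ⟨u, hu, hu2⟩ := exact_W (X.hom_d 0) X.hom_ε X.exact_ε (incl_supp v) h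
      refine ⟨resW K W _ u, ?_⟩
      rw [LinearMap.comp_apply, LinearMap.comp_apply, incl_resW hu, hu2, resW_incl]
    · rintro ⟨u, rfl⟩
      rw [LinearMap.comp_apply, LinearMap.comp_apply,
        incl_resW (suppW_map (X.hom_d 0) (incl_supp u)), ← LinearMap.mem_ker, X.exact_ε]
      exact ⟨_, rfl⟩
  exact_d := by
    intro i
    ext v
    rw [LinearMap.mem_ker, LinearMap.mem_range]
    have h0 : (resW K W (X.deg i) ∘ₗ X.d i ∘ₗ incl K W (X.deg (i + 1))) v = 0 ↔
        X.d i (incl K W (X.deg (i + 1)) v) = 0 := by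
      rw [LinearMap.comp_apply, LinearMap.comp_apply]
      constructor
      · intro h
        rw [← incl_resW (suppW_map (X.hom_d i) (incl_supp v)), h, map_zero]
      · intro h
        rw [h, map_zero]
    rw [h0]
    constructor
    · intro h
      obtain ⟨u, hu, hu2⟩ := exact_W (X.hom_d (i + 1)) (X.hom_d i) (X.exact_d i) (incl_supp v) h
      refine ⟨resW K W _ u, ?_⟩
      rw [LinearMap.comp_apply, LinearMap.comp_apply, incl_resW hu, hu2, resW_incl]
    · rintro ⟨u, rfl⟩
      rw [LinearMap.comp_apply, LinearMap.comp_apply,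
        incl_resW (suppW_map (X.hom_d (i + 1)) (incl_supp u)), ← LinearMap.mem_ker, X.exact_d]
      exact ⟨_, rfl⟩
  homog_ε := by
    intro b
    rw [LinearMap.comp_apply, LinearMap.comp_apply, incl_single, Finsupp.lapply_apply]
    rcases homog_of_hg (X.hom_ε b.1) () with h | ⟨-, h⟩
    · rw [h]; exact isHomogeneous_zero _ _ _
    · have h2 : Finsupp.degree (0 : σ →₀ ℕ) = 0 := map_zero _
      rwa [h2, tsub_zero] at h
  homog_d := by
    intro i b c
    rw [LinearMap.comp_apply, LinearMap.comp_apply, incl_single, resW_apply]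
    exact homog_of_hg (X.hom_d i b.1) c.1
  minimal := by
    intro i b c
    rw [LinearMap.comp_apply, LinearMap.comp_apply, incl_single, resW_apply]
    exact X.min i _ _

theorem restr_betti_le {A : Set (σ →₀ ℕ)} (X : GRm K A)
    (W : Set σ) (i j : ℕ) : (restr X W).betti i j ≤ (restr X Set.univ).betti i j := by
  have := X.fin i
  have hf : Finite {b : (restr X Set.univ).ι i // (restr X Set.univ).deg i b = j} := by
    have := (restr X Set.univ).finite i
    infer_instance
  apply Nat.card_le_card_of_injective
    (fun b : {b : (restr X W).ι i // (restr X W).deg i b = j} =>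
      (⟨⟨b.1.1, fun k hk => absurd (Set.mem_univ k) hk⟩, b.2⟩ :
        {b : (restr X Set.univ).ι i // (restr X Set.univ).deg i b = j}))
  intro b b' h
  apply Subtype.ext
  apply Subtype.ext
  exact congrArg (fun x => x.1.1) h

end Restrict

/-! ### Comparison of two resolutions -/

section Final

variable {K : Type} [Field K] {σ : Type} {I : Ideal (MvPolynomial σ K)}

/-- Index types of the augmented complex. -/
def aι (R : MinimalGradedFreeResolution I) : ℕ → Type
  | 0 => Unit
  | i + 1 => R.ι i

/-- Degrees of the augmented complex. -/
def adeg (R : MinimalGradedFreeResolution I) : ∀ i, aι R i → ℕ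
  | 0 => fun _ => 0
  | i + 1 => R.deg i

/-- Differentials of the augmented complex. -/
noncomputable def ad (R : MinimalGradedFreeResolution I) : ∀ i,
    (aι R (i + 1) →₀ MvPolynomial σ K) →ₗ[MvPolynomial σ K] (aι R i →₀ MvPolynomial σ K)
  | 0 => (Finsupp.lsingle () : MvPolynomial σ K →ₗ[MvPolynomial σ K] _) ∘ₗ R.ε
  | i + 1 => R.d i

theorem lsingle_eq_zero (p : MvPolynomial σ K) :
    (Finsupp.lsingle () : MvPolynomial σ K →ₗ[MvPolynomial σ K] (Unit →₀ MvPolynomial σ K)) p = 0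
      ↔ p = 0 := by
  rw [Finsupp.lsingle_apply, Finsupp.single_eq_zero]

theorem dmin (R : MinimalGradedFreeResolution I) (i : ℕ) (v : R.ι (i + 1) →₀ MvPolynomial σ K)
    (c : R.ι i) : constantCoeff (R.d i v c) = 0 := by
  rw [apply_sum, Finsupp.sum, map_sum]
  apply Finset.sum_eq_zero
  intro b _
  rw [map_mul, R.minimal, mul_zero]

theorem range_mem (R R' : MinimalGradedFreeResolution I) (v : R.ι 0 →₀ MvPolynomial σ K) :
    ∃ u, R'.ε u = R.ε v := by
  have h : R.ε v ∈ LinearMap.range R.ε := ⟨v, rfl⟩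
  have h2 : LinearMap.range R.ε = LinearMap.range R'.ε := R.range_ε.trans R'.range_ε.symm
  rw [h2] at h
  exact h

/-- The augmented complex. -/
noncomputable def toGC (R : MinimalGradedFreeResolution I) : GC K σ where
  ι := aι R
  deg := adeg R
  d := ad R
  hom := by
    intro i b
    cases i with
    | zero =>
      intro c m hm
      have h1 : coeff m (R.ε (Finsupp.single b 1)) ≠ 0 := by
        have h0 : coeff m ((Finsupp.single () (R.ε (Finsupp.single b 1)) :
          Unit →₀ MvPolynomial σ K) ()) ≠ 0 := hm
        rwa [Finsupp.single_eq_same] at h0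
      have h2 := R.homog_ε b h1
      have h3 : m.degree = Finsupp.weight 1 m := degree_w m
      exact h3.trans h2
    | succ i =>
      intro c m hm
      have h1 : coeff m (R.d i (Finsupp.single b 1) c) ≠ 0 := hm
      rcases R.homog_d i b c with h | ⟨hle, h⟩
      · rw [h] at h1
        simp at h1
      · have h2 := h h1
        have h3 : m.degree = Finsupp.weight 1 m := degree_w m
        rw [← h3] at h2
        change m.degree + R.deg i c = R.deg (i + 1) b
        omega
  exact := by
    intro i
    cases i with
    | zero =>
      refine Eq.trans ?_ R.exact_ε
      ext v
      exact lsingle_eq_zero (R.ε v)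
    | succ i => exact R.exact_d i
  min := by
    intro i v c
    exact dmin R i v c

theorem cmp_zero (R R' : MinimalGradedFreeResolution I) : Cmp (toGC R) (toGC R') 0 := by
  have key : ∀ (R R' : MinimalGradedFreeResolution I) v,
      (toGC R).d 0 v ∈ LinearMap.range ((toGC R').d 0) := by
    intro R R' v
    obtain ⟨u, hu⟩ := range_mem R R' v
    exact ⟨u, congrArg (Finsupp.single ()) hu⟩
  refine ⟨LinearMap.id, LinearMap.id, 0, ?_, key R R', key R' R, ?_, ?_, ?_⟩
  · intro b
    exact hg_single (deg := fun _ : Unit => 0) b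
  · intro v
    simp only [LinearMap.zero_apply, map_zero]
    exact sub_self _
  · intro v c
    simp
  · intro v c
    have : ∀ x : (toGC R).ι 0 →₀ MvPolynomial σ K, constantCoeff ((x - x) c) = 0 := by
      intro x
      rw [sub_self]
      simp
    exact this v

theorem betti_le (R R' : MinimalGradedFreeResolution I) (i j : ℕ) :
    R.betti i j ≤ R'.betti i j := by
  have h : ∀ i, Cmp (toGC R) (toGC R') i := by
    intro i
    induction i with
    | zero => exact cmp_zero R R'
    | succ i ih => exact cmp_succ _ _ i ih
  have : Finite ((toGC R).ι (i + 1)) := R.finite i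
  have : Finite ((toGC R').ι (i + 1)) := R'.finite i
  exact cmp_card (toGC R) (toGC R') (i + 1) j (h (i + 1))

theorem betti_eq (R : MinimalGradedFreeResolution I) (i j : ℕ) :
    bettiNumber I i j = R.betti i j := by
  apply le_antisymm
  · refine csSup_le (s := {b | ∃ R : MinimalGradedFreeResolution I, R.betti i j = b})
      ⟨_, R, rfl⟩ ?_
    rintro _ ⟨R', rfl⟩
    exact betti_le R' R i j
  · refine le_csSup ⟨R.betti i j, ?_⟩ ⟨R, rfl⟩
    rintro _ ⟨R', rfl⟩
    exact betti_le R' R i j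

theorem monI_betti_le [Finite σ] (A : Set (σ →₀ ℕ)) (W : Set σ) (i j : ℕ) :
    bettiNumber (monI K {a ∈ A | InW W a}) i j ≤ bettiNumber (monI K A) i j := by
  obtain ⟨X⟩ := exists_GR (w := AddMonoidHom.id (σ →₀ ℕ)) (fun m h => h)
    ⟨Unit, inferInstance, fun _ => 0, baseN K A, pr_base A⟩
  have hA : {a ∈ A | InW Set.univ a} = A := by
    ext a
    simp [InW]
  have h1 := betti_eq (restr X W) i j
  have h2 := betti_eq (restr X Set.univ) i j
  have h3 : bettiNumber (monI K A) i j = bettiNumber (monI K {a ∈ A | InW Set.univ a}) i j := by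
    rw [hA]
  rw [h1, h3, h2]
  exact restr_betti_le X W i j

theorem XX_eq (a b : σ) : (X a * X b : MvPolynomial σ K) =
    monomial (Finsupp.single a 1 + Finsupp.single b 1) 1 := by
  simp [X, monomial_mul]

end Final

end BettiProof

/-- if `H` is the induced subgraph of `G` on a vertex subset `W`, then
`β_{i,j}(I(H̄)) ≤ β_{i,j}(I(Ḡ))` for all `i, j` (both ideals in `K[x₁,…,xₙ]`). -/
theorem stmt5 (K : Type) [Field K] (n : ℕ) (G : SimpleGraph (Fin n)) (W : Set (Fin n)) :
    ∀ i j : ℕ,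
      bettiNumber (Ideal.span {p : MvPolynomial (Fin n) K |
          ∃ a b : Fin n, a ∈ W ∧ b ∈ W ∧ a ≠ b ∧ ¬ G.Adj a b ∧ p = X a * X b}) i j ≤
      bettiNumber (edgeIdeal K Gᶜ) i j := by
  intro i j
  have key := BettiProof.monI_betti_le (K := K)
    {m | ∃ a b : Fin n, Gᶜ.Adj a b ∧ m = Finsupp.single a 1 + Finsupp.single b 1} W i j
  convert key using 2
  · unfold BettiProof.monI
    congr 1
    ext p
    constructor
    · rintro ⟨a, b, ha, hb, hab, hG, rfl⟩
      refine ⟨_, ⟨⟨a, b, ⟨hab, hG⟩, rfl⟩, ?_⟩, (BettiProof.XX_eq a b).symm⟩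
      intro k hk
      have h1 : a ≠ k := fun h => hk (h ▸ ha)
      have h2 : b ≠ k := fun h => hk (h ▸ hb)
      simp [h1, h2]
    · rintro ⟨_, ⟨⟨a, b, hab, rfl⟩, hW⟩, rfl⟩
      refine ⟨a, b, ?_, ?_, hab.1, hab.2, (BettiProof.XX_eq a b).symm⟩
      · by_contra ha
        have := hW a ha
        simp at this
      · by_contra hb
        have := hW b hb
        simp at this
  · unfold BettiProof.monI edgeIdeal
    congr 1
    ext p
    constructor
    · rintro ⟨a, b, hab, rfl⟩
      exact ⟨_, ⟨a, b, hab, rfl⟩, (BettiProof.XX_eq a b).symm⟩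
    · rintro ⟨_, ⟨a, b, hab, rfl⟩, rfl⟩
      exact ⟨a, b, hab, (BettiProof.XX_eq a b).symm⟩
end

section
/- Let I ≠ 0 be a square-free monomial ideal generated in degree 2 in K[x_1,…,x_n,z_1,…,z_r] such that z_i z_j ∉ I for all 1 ≤ i < j ≤ r, and let J = I + (x_i y_j : 1 ≤ i ≤ n, 1 ≤ j ≤ m) in S = K[x,y,z]. Then reg(I) = reg(J). -/
open MvPolynomial

open MvPolynomial

section Grading

variable {K : Type} [Field K] {σ : Type} {ι κ : Type}

/-- `v` is homogeneous of degree `D` in the graded free module with generator degrees `deg`. -/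
def GH (deg : ι → ℕ) (D : ℕ) (v : ι →₀ MvPolynomial σ K) : Prop :=
  ∀ c k, coeff k (v c) ≠ 0 → deg c + k.degree = D

theorem gh_entry (p : MvPolynomial σ K) (a D : ℕ) :
    (∀ k, coeff k p ≠ 0 → a + k.degree = D) ↔
      (p = 0 ∨ (a ≤ D ∧ p.IsHomogeneous (D - a))) := by
  constructor
  · intro h
    by_cases hp : p = 0
    · exact Or.inl hp
    · right
      obtain ⟨k, hk⟩ := MvPolynomial.ne_zero_iff.1 hp
      have := h k hk
      refine ⟨by omega, ?_⟩
      intro k' hk'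
      have := h k' hk'
      have e : Finsupp.weight (1 : σ → ℕ) k' = k'.degree :=
        (DFunLike.congr_fun (Finsupp.degree_eq_weight_one (R := ℕ)) k').symm
      rw [e]
      omega
  · rintro (rfl | ⟨h1, h2⟩) k hk
    · simp at hk
    · have := h2 hk
      have e : Finsupp.weight (1 : σ → ℕ) k = k.degree :=
        (DFunLike.congr_fun (Finsupp.degree_eq_weight_one (R := ℕ)) k).symm
      rw [e] at this
      omega

theorem gh_iff (deg : ι → ℕ) (D : ℕ) (v : ι →₀ MvPolynomial σ K) :
    GH deg D v ↔ ∀ c, (v c = 0 ∨ (deg c ≤ D ∧ (v c).IsHomogeneous (D - deg c))) := by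
  unfold GH
  exact forall_congr' fun c => gh_entry _ _ _

theorem GH.zero (deg : ι → ℕ) (D : ℕ) : GH deg D (0 : ι →₀ MvPolynomial σ K) := by
  intro c k h; simp at h

theorem GH.add {deg : ι → ℕ} {D : ℕ} {v w : ι →₀ MvPolynomial σ K} (hv : GH deg D v)
    (hw : GH deg D w) : GH deg D (v + w) := by
  intro c k h
  by_cases h1 : coeff k (v c) = 0
  · apply hw; intro h2; apply h; simp [h1, h2]
  · exact hv _ _ h1

theorem GH.single (deg : ι → ℕ) (b : ι) :
    GH deg (deg b) (Finsupp.single b (1 : MvPolynomial σ K)) := by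
  classical
  intro c k h
  by_cases hb : b = c
  · subst hb
    rw [Finsupp.single_eq_same, coeff_one] at h
    by_cases hk : 0 = k
    · subst hk; simp
    · simp [hk] at h
  · simp [hb] at h

theorem GH.monomial_smul {deg : ι → ℕ} {D : ℕ} {v : ι →₀ MvPolynomial σ K}
    (hv : GH deg D v) (k : σ →₀ ℕ) (a : K) :
    GH deg (D + k.degree) (monomial k a • v) := by
  classical
  intro c l h
  rw [Finsupp.smul_apply, smul_eq_mul, coeff_monomial_mul'] at h
  split_ifs at h with hkl
  · have := hv c (l - k) (fun h0 => h (by simp [h0]))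
    have e : (l - k) + k = l := tsub_add_cancel_of_le hkl
    have e2 : l.degree = (l - k).degree + k.degree := by
      conv_lhs => rw [← e]
      simp
    omega
  · exact absurd rfl h

/-- The degree `D` component. -/
noncomputable def gcomp (deg : ι → ℕ) (D : ℕ) (v : ι →₀ MvPolynomial σ K) : ι →₀ MvPolynomial σ K :=
  Finsupp.onFinset v.support
    (fun c => if deg c ≤ D then homogeneousComponent (D - deg c) (v c) else 0) (by
      intro c h
      rw [Finsupp.mem_support_iff]
      intro h0
      apply h
      simp [h0])

theorem coeff_gcomp (deg : ι → ℕ) (D : ℕ) (v : ι →₀ MvPolynomial σ K) (c : ι) (k : σ →₀ ℕ) :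
    coeff k (gcomp deg D v c) = if deg c + k.degree = D then coeff k (v c) else 0 := by
  classical
  unfold gcomp
  rw [Finsupp.onFinset_apply]
  by_cases h : deg c ≤ D
  · rw [if_pos h, coeff_homogeneousComponent]
    congr 1
    apply propext
    omega
  · rw [if_neg h, if_neg (by omega)]
    simp

theorem gh_ext {v w : ι →₀ MvPolynomial σ K} (h : ∀ c k, coeff k (v c) = coeff k (w c)) :
    v = w := by
  ext c k; exact h c k

theorem gcomp_gh (deg : ι → ℕ) (D : ℕ) (v : ι →₀ MvPolynomial σ K) :
    GH deg D (gcomp deg D v) := by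
  intro c k h
  rw [coeff_gcomp] at h
  by_contra h0
  exact h (if_neg h0)

theorem gcomp_add (deg : ι → ℕ) (D : ℕ) (v w : ι →₀ MvPolynomial σ K) :
    gcomp deg D (v + w) = gcomp deg D v + gcomp deg D w := by
  apply gh_ext; intro c k
  simp only [coeff_gcomp, Finsupp.add_apply, coeff_add]
  split_ifs <;> simp

theorem gcomp_zero (deg : ι → ℕ) (D : ℕ) :
    gcomp deg D (0 : ι →₀ MvPolynomial σ K) = 0 := by
  apply gh_ext; intro c k
  simp [coeff_gcomp]

theorem GH.gcomp_eq {deg : ι → ℕ} {D : ℕ} {v : ι →₀ MvPolynomial σ K} (hv : GH deg D v)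
    (D' : ℕ) : gcomp deg D' v = if D = D' then v else 0 := by
  apply gh_ext; intro c k
  rw [coeff_gcomp]
  by_cases h : coeff k (v c) = 0
  · split_ifs <;> simp [h]
  · have := hv c k h
    rw [this]
    split_ifs <;> simp

theorem GH.comp_map {deg : ι → ℕ} {deg' : κ → ℕ}
    {d : (ι →₀ MvPolynomial σ K) →ₗ[MvPolynomial σ K] (κ →₀ MvPolynomial σ K)}
    (hd : ∀ b, GH deg' (deg b) (d (Finsupp.single b 1))) (D : ℕ)
    (v : ι →₀ MvPolynomial σ K) :
    d (gcomp deg D v) = gcomp deg' D (d v) := by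
  induction v using Finsupp.induction_linear with
  | zero => simp [gcomp_zero]
  | add v w hv hw => simp [gcomp_add, hv, hw]
  | single b p =>
    induction p using MvPolynomial.induction_on' with
    | add p q hp hq => simp only [Finsupp.single_add, map_add, gcomp_add, hp, hq]
    | monomial k a =>
      have e : (Finsupp.single b (monomial k a) : ι →₀ MvPolynomial σ K)
          = monomial k a • Finsupp.single b 1 := by simp
      rw [e, ((GH.single deg b).monomial_smul k a).gcomp_eq, map_smul,
        ((hd b).monomial_smul k a).gcomp_eq]
      split_ifs
      · rw [map_smul]
      · simp

theorem GH.map {deg : ι → ℕ} {deg' : κ → ℕ}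
    {d : (ι →₀ MvPolynomial σ K) →ₗ[MvPolynomial σ K] (κ →₀ MvPolynomial σ K)}
    (hd : ∀ b, GH deg' (deg b) (d (Finsupp.single b 1))) {D : ℕ}
    {v : ι →₀ MvPolynomial σ K} (hv : GH deg D v) : GH deg' D (d v) := by
  have := GH.comp_map hd D v
  rw [hv.gcomp_eq, if_pos rfl] at this
  rw [this]; exact gcomp_gh _ _ _

/-- Graded lifting. -/
theorem GH.lift {deg : ι → ℕ} {deg' : κ → ℕ}
    {d : (ι →₀ MvPolynomial σ K) →ₗ[MvPolynomial σ K] (κ →₀ MvPolynomial σ K)}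
    (hd : ∀ b, GH deg' (deg b) (d (Finsupp.single b 1))) {D : ℕ}
    {v : κ →₀ MvPolynomial σ K} (hv : GH deg' D v) (hr : v ∈ LinearMap.range d) :
    ∃ w, GH deg D w ∧ d w = v := by
  obtain ⟨w, rfl⟩ := hr
  refine ⟨gcomp deg D w, gcomp_gh _ _ _, ?_⟩
  rw [GH.comp_map hd, hv.gcomp_eq, if_pos rfl]

theorem lift_map {μ : Type} {deg : ι → ℕ} {deg' : κ → ℕ} {degm : μ → ℕ}
    {d : (ι →₀ MvPolynomial σ K) →ₗ[MvPolynomial σ K] (κ →₀ MvPolynomial σ K)}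
    (hd : ∀ b, GH deg' (deg b) (d (Finsupp.single b 1)))
    (f : (μ →₀ MvPolynomial σ K) →ₗ[MvPolynomial σ K] (κ →₀ MvPolynomial σ K))
    (hf : ∀ b, GH deg' (degm b) (f (Finsupp.single b 1)))
    (hr : ∀ v, f v ∈ LinearMap.range d) :
    ∃ g : (μ →₀ MvPolynomial σ K) →ₗ[MvPolynomial σ K] (ι →₀ MvPolynomial σ K),
      (∀ b, GH deg (degm b) (g (Finsupp.single b 1))) ∧ ∀ v, d (g v) = f v := by
  choose w hw1 hw2 using fun b => GH.lift hd (hf b) (hr _)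
  refine ⟨Finsupp.linearCombination _ w, fun b => ?_, fun v => ?_⟩
  · simpa using hw1 b
  · have : d ∘ₗ Finsupp.linearCombination _ w = f := by
      apply Finsupp.lhom_ext'
      intro b
      ext1
      simp [hw2]
    exact LinearMap.congr_fun this v

theorem lift_map_ungraded {μ : Type}
    (d : (ι →₀ MvPolynomial σ K) →ₗ[MvPolynomial σ K] (κ →₀ MvPolynomial σ K))
    (f : (μ →₀ MvPolynomial σ K) →ₗ[MvPolynomial σ K] (κ →₀ MvPolynomial σ K))
    (hr : ∀ v, f v ∈ LinearMap.range d) :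
    ∃ g : (μ →₀ MvPolynomial σ K) →ₗ[MvPolynomial σ K] (ι →₀ MvPolynomial σ K),
      ∀ v, d (g v) = f v := by
  choose w hw2 using fun b => hr (Finsupp.single b 1)
  refine ⟨Finsupp.linearCombination _ w, fun v => ?_⟩
  have : d ∘ₗ Finsupp.linearCombination _ w = f := by
      apply Finsupp.lhom_ext'
      intro b
      ext1
      simp [hw2]
  exact LinearMap.congr_fun this v

/-- Maps with matrix entries in the maximal ideal. -/
theorem cc_map (d : (ι →₀ MvPolynomial σ K) →ₗ[MvPolynomial σ K] (κ →₀ MvPolynomial σ K))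
    (hd : ∀ b c, constantCoeff (d (Finsupp.single b 1) c) = 0) (v : ι →₀ MvPolynomial σ K)
    (c : κ) : constantCoeff (d v c) = 0 := by
  induction v using Finsupp.induction_linear with
  | zero => simp
  | add v w hv hw => simp [hv, hw]
  | single b p =>
    have e : (Finsupp.single b p : ι →₀ MvPolynomial σ K) = p • Finsupp.single b 1 := by simp
    rw [e, map_smul, Finsupp.smul_apply, smul_eq_mul, map_mul, hd, mul_zero]

theorem cc_map' (d : (ι →₀ MvPolynomial σ K) →ₗ[MvPolynomial σ K] (κ →₀ MvPolynomial σ K))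
    (v : ι →₀ MvPolynomial σ K) (hv : ∀ b, constantCoeff (v b) = 0)
    (c : κ) : constantCoeff (d v c) = 0 := by
  have : d v = v.sum fun b p => p • d (Finsupp.single b 1) := by
    conv_lhs => rw [← Finsupp.sum_single v]
    rw [Finsupp.sum, map_sum]
    apply Finset.sum_congr rfl
    intro b _
    show _ = v b • _
    rw [← map_smul]; simp
  rw [this, Finsupp.sum, Finsupp.finsetSum_apply, map_sum]
  apply Finset.sum_eq_zero
  intro b _
  simp [hv]

end Grading

section Comparison

/-- Exact sequence of graded free modules. -/
structure GCpx (K : Type) [Field K] (σ : Type) where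
  ι : ℕ → Type
  deg : ∀ i, ι i → ℕ
  d : ∀ i, (ι (i + 1) →₀ MvPolynomial σ K) →ₗ[MvPolynomial σ K] (ι i →₀ MvPolynomial σ K)
  homog : ∀ i b, GH (deg i) (deg (i + 1) b) (d i (Finsupp.single b 1))
  exact : ∀ i, LinearMap.ker (d i) = LinearMap.range (d (i + 1))

variable {K : Type} [Field K] {σ : Type}

theorem GCpx.dd (A : GCpx K σ) (i : ℕ) (v) : A.d i (A.d (i + 1) v) = 0 := by
  have : A.d (i + 1) v ∈ LinearMap.ker (A.d i) := by
    rw [A.exact]; exact ⟨v, rfl⟩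
  exact this

theorem GCpx.ex (A : GCpx K σ) (i : ℕ) (v) (h : A.d i v = 0) :
    v ∈ LinearMap.range (A.d (i + 1)) := by
  rw [← A.exact]; exact h

/-- Dependent recursion producing a sequence. -/
theorem exists_dep_seq {X : ℕ → Type} (P : ∀ i, X i → Prop) (Q : ∀ i, X i → X (i + 1) → Prop)
    (x0 : X 0) (h0 : P 0 x0) (step : ∀ i x, P i x → ∃ y, P (i + 1) y ∧ Q i x y) :
    ∃ s : ∀ i, X i, s 0 = x0 ∧ (∀ i, P i (s i)) ∧ ∀ i, Q i (s i) (s (i + 1)) := by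
  classical
  choose nx h1 h2 using step
  let s : ∀ i, {x : X i // P i x} := fun i =>
    Nat.rec (motive := fun i => {x : X i // P i x}) ⟨x0, h0⟩ (fun i x => ⟨nx i x.1 x.2, h1 i x.1 x.2⟩) i
  exact ⟨fun i => (s i).1, rfl, fun i => (s i).2, fun i => h2 i _ (s i).2⟩

theorem comparison (A B : GCpx K σ)
    (f0 : (A.ι 0 →₀ MvPolynomial σ K) →ₗ[MvPolynomial σ K] (B.ι 0 →₀ MvPolynomial σ K))
    (hf0 : ∀ b, GH (B.deg 0) (A.deg 0 b) (f0 (Finsupp.single b 1)))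
    (hr : ∀ v, f0 (A.d 0 v) ∈ LinearMap.range (B.d 0)) :
    ∃ f : ∀ i, (A.ι i →₀ MvPolynomial σ K) →ₗ[MvPolynomial σ K] (B.ι i →₀ MvPolynomial σ K),
      f 0 = f0 ∧ (∀ i b, GH (B.deg i) (A.deg i b) (f i (Finsupp.single b 1))) ∧
      ∀ i v, B.d i (f (i + 1) v) = f i (A.d i v) := by
  obtain ⟨f, h0, h1, h2⟩ := exists_dep_seq
    (X := fun i => (A.ι i →₀ MvPolynomial σ K) →ₗ[MvPolynomial σ K] (B.ι i →₀ MvPolynomial σ K))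
    (fun i f => (∀ b, GH (B.deg i) (A.deg i b) (f (Finsupp.single b 1))) ∧
      ∀ v, f (A.d i v) ∈ LinearMap.range (B.d i))
    (fun i f g => ∀ v, B.d i (g v) = f (A.d i v)) f0 ⟨hf0, hr⟩ (by
      rintro i f ⟨hf1, hf2⟩
      obtain ⟨g, hg1, hg2⟩ := lift_map (degm := A.deg (i + 1)) (B.homog i) (f ∘ₗ A.d i)
        (fun b => GH.map hf1 (A.homog i b)) (fun v => hf2 v)
      refine ⟨g, ⟨hg1, fun v => B.ex i _ ?_⟩, hg2⟩
      rw [hg2, LinearMap.comp_apply, A.dd, map_zero])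
  exact ⟨f, h0, fun i => (h1 i).1, h2⟩

theorem homotopy (A : GCpx K σ)
    (e : ∀ i, (A.ι i →₀ MvPolynomial σ K) →ₗ[MvPolynomial σ K] (A.ι i →₀ MvPolynomial σ K))
    (h0 : e 0 = LinearMap.id) (he : ∀ i v, A.d i (e (i + 1) v) = e i (A.d i v)) :
    ∃ h : ∀ i, (A.ι i →₀ MvPolynomial σ K) →ₗ[MvPolynomial σ K] (A.ι (i + 1) →₀ MvPolynomial σ K),
      h 0 = 0 ∧ ∀ i v, e (i + 1) v = v + h i (A.d i v) + A.d (i + 1) (h (i + 1) v) := by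
  obtain ⟨h, h0, h1, h2⟩ := exists_dep_seq
    (X := fun i => (A.ι i →₀ MvPolynomial σ K) →ₗ[MvPolynomial σ K] (A.ι (i + 1) →₀ MvPolynomial σ K))
    (fun i h => ∀ v, e i (A.d i v) = A.d i v + A.d i (h (A.d i v)))
    (fun i h g => ∀ v, e (i + 1) v = v + h (A.d i v) + A.d (i + 1) (g v)) 0 (by
      intro v; simp [h0]) (by
      intro i h hh
      obtain ⟨g, hg⟩ := lift_map_ungraded (A.d (i + 1))
        (e (i + 1) - LinearMap.id - h ∘ₗ A.d i) (fun v => A.ex i _ (by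
          simp [he, hh]))
      have hg' : ∀ v, e (i + 1) v = v + h (A.d i v) + A.d (i + 1) (g v) := by
        intro v; rw [hg]; simp
      refine ⟨g, fun v => ?_, hg'⟩
      conv_lhs => rw [hg']
      rw [A.dd, map_zero, add_zero])
  exact ⟨h, h0, h2⟩

open scoped Classical in
theorem homotopy_cc (A : GCpx K σ)
    (hmin : ∀ i b c, constantCoeff (A.d (i + 1) (Finsupp.single b 1) c) = 0)
    (e : ∀ i, (A.ι i →₀ MvPolynomial σ K) →ₗ[MvPolynomial σ K] (A.ι i →₀ MvPolynomial σ K))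
    (h0 : e 0 = LinearMap.id) (he : ∀ i v, A.d i (e (i + 1) v) = e i (A.d i v)) (i : ℕ)
    (b c : A.ι (i + 1)) :
    constantCoeff (e (i + 1) (Finsupp.single b 1) c) = if b = c then 1 else 0 := by
  obtain ⟨h, h0, h1⟩ := homotopy A e h0 he
  rw [h1]
  have hA : constantCoeff (h i (A.d i (Finsupp.single b 1)) c) = 0 := by
    cases i with
    | zero => rw [h0]; simp
    | succ i =>
      apply cc_map'
      intro c'
      exact hmin i b c'
  have hB : constantCoeff (A.d (i + 1) (h (i + 1) (Finsupp.single b 1)) c) = 0 := by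
    apply cc_map
    intro b' c'
    exact hmin i b' c'
  rw [Finsupp.add_apply, Finsupp.add_apply, map_add, map_add, hA, hB, add_zero, add_zero,
    Finsupp.single_apply]
  split_ifs <;> simp

variable {I : Ideal (MvPolynomial σ K)}

/-- The augmented exact sequence of a minimal graded free resolution. -/
noncomputable def MinimalGradedFreeResolution.aug (R : MinimalGradedFreeResolution I) : GCpx K σ where
  ι := fun i => Nat.casesOn i Unit R.ι
  deg := fun i => match i with
    | 0 => fun _ => 0
    | i + 1 => R.deg i
  d := fun i => match i with
    | 0 => Finsupp.lsingle () ∘ₗ R.ε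
    | i + 1 => R.d i
  homog := by
    rintro (_ | i) b
    · intro c k h
      have h' : coeff k (R.ε (Finsupp.single b 1)) ≠ 0 := by
        have e : (Finsupp.single () (R.ε (Finsupp.single b 1)) : Unit →₀ MvPolynomial σ K) c
          = R.ε (Finsupp.single b 1) := by cases c; simp
        rw [← e]; exact h
      have := (gh_entry (R.ε (Finsupp.single b 1)) 0 (R.deg 0 b)).2
        (Or.inr ⟨Nat.zero_le _, by simpa using R.homog_ε b⟩) k h'
      simpa using this
    · exact (gh_iff _ _ _).2 (R.homog_d i b)
  exact := by
    rintro (_ | i)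
    · show LinearMap.ker (Finsupp.lsingle () ∘ₗ R.ε) = LinearMap.range (R.d 0)
      rw [← R.exact_ε]
      ext v
      simp
    · exact R.exact_d i

theorem mgfr_compare {I' : Ideal (MvPolynomial σ K)} (R : MinimalGradedFreeResolution I)
    (R' : MinimalGradedFreeResolution I') (hII : I ≤ I') :
    ∃ f : ∀ i, (R.aug.ι i →₀ MvPolynomial σ K) →ₗ[MvPolynomial σ K]
        (R'.aug.ι i →₀ MvPolynomial σ K),
      f 0 = (LinearMap.id : (Unit →₀ MvPolynomial σ K) →ₗ[MvPolynomial σ K] (Unit →₀ MvPolynomial σ K)) ∧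
      (∀ i b, GH (R'.aug.deg i) (R.aug.deg i b) (f i (Finsupp.single b 1))) ∧
      ∀ i v, R'.aug.d i (f (i + 1) v) = f i (R.aug.d i v) := by
  apply comparison R.aug R'.aug
    (LinearMap.id : (Unit →₀ MvPolynomial σ K) →ₗ[MvPolynomial σ K] (Unit →₀ MvPolynomial σ K))
  · intro b
    exact GH.single (fun _ : Unit => 0) b
  · intro v
    have : R.ε v ∈ LinearMap.range R'.ε := by
      rw [R'.range_ε]; apply hII
      exact R.range_ε.le ⟨v, rfl⟩
    obtain ⟨w, hw⟩ := this
    refine ⟨w, ?_⟩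
    show Finsupp.single () (R'.ε w) = Finsupp.single () (R.ε v)
    rw [hw]

theorem betti_le (R R' : MinimalGradedFreeResolution I) (i j : ℕ) :
    R.betti i j ≤ R'.betti i j := by
  classical
  obtain ⟨f, f0, f1, f2⟩ := mgfr_compare R R' le_rfl
  obtain ⟨g, g0, g1, g2⟩ := mgfr_compare R' R le_rfl
  have key := homotopy_cc R.aug (fun i b c => R.minimal i b c) (fun i => g i ∘ₗ f i)
    (by
      show g 0 ∘ₗ f 0 = _
      rw [f0, g0]; rfl) (by
      intro i v
      simp only [LinearMap.comp_apply, g2, f2]) i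
  let F : (R.ι i →₀ MvPolynomial σ K) →ₗ[MvPolynomial σ K] (R'.ι i →₀ MvPolynomial σ K) := f (i + 1)
  let G : (R'.ι i →₀ MvPolynomial σ K) →ₗ[MvPolynomial σ K] (R.ι i →₀ MvPolynomial σ K) := g (i + 1)
  have F1 : ∀ b, GH (R'.deg i) (R.deg i b) (F (Finsupp.single b 1)) := f1 (i + 1)
  have key' : ∀ b c : R.ι i, constantCoeff (G (F (Finsupp.single b 1)) c)
      = if b = c then 1 else 0 := key
  clear_value F G
  clear key g2 f2 g1 f1 g0 f0 f g
  have := R.finite i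
  have := R'.finite i
  let β := {b : R.ι i // R.deg i b = j}
  let β' := {b : R'.ι i // R'.deg i b = j}
  let _ : Fintype β := Fintype.ofFinite _
  let _ : Fintype β' := Fintype.ofFinite _
  let _ : Fintype (R'.ι i) := Fintype.ofFinite _
  let M : Matrix β' β K := fun c b => constantCoeff (F (Finsupp.single b.1 1) c.1)
  let N : Matrix β β' K := fun b c => constantCoeff (G (Finsupp.single c.1 1) b.1)
  have hNM : N * M = 1 := by
    ext b c
    rw [Matrix.mul_apply, Matrix.one_apply]
    have e1 := key' c.1 b.1
    have e2 : F (Finsupp.single c.1 1) =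
        ∑ x, (F (Finsupp.single c.1 1) x) • Finsupp.single x (1 : MvPolynomial σ K) := by
      ext1 y
      simp
    rw [e2, map_sum, Finsupp.finsetSum_apply, map_sum] at e1
    have e3 : ∀ x : R'.ι i, constantCoeff (G ((F (Finsupp.single c.1 1) x) •
        Finsupp.single x (1 : MvPolynomial σ K)) b.1)
        = constantCoeff (F (Finsupp.single c.1 1) x) *
          constantCoeff (G (Finsupp.single x 1) b.1) := by
      intro x; rw [map_smul, Finsupp.smul_apply, smul_eq_mul, map_mul]
    simp only [e3] at e1
    have e4 : ∑ x : β', N b x * M x c = ∑ x : R'.ι i,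
        constantCoeff (F (Finsupp.single c.1 1) x) *
          constantCoeff (G (Finsupp.single x 1) b.1) := by
      rw [← Finset.sum_subset (Finset.subset_univ
        (Finset.univ.filter fun x : R'.ι i => R'.deg i x = j))]
      · rw [Finset.sum_subtype (p := fun x : R'.ι i => R'.deg i x = j) _ (by simp)]
        apply Finset.sum_congr rfl
        intro x _
        exact mul_comm _ _
      · intro x _ hx
        have : constantCoeff (F (Finsupp.single c.1 1) x) = 0 := by
          by_contra h
          have := F1 c.1 x 0 h
          apply hx
          simp only [map_zero, add_zero] at this
          simp [this, c.2]
        rw [this, zero_mul]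
    rw [e4, e1]
    by_cases hbc : b = c
    · simp [hbc]
    · rw [if_neg hbc, if_neg (fun h => hbc (Subtype.ext h.symm))]
  have inj : Function.Injective M.mulVecLin := by
    intro u v huv
    have := congrArg N.mulVecLin huv
    simpa [Matrix.mulVec_mulVec, hNM] using this
  have := LinearMap.finrank_le_finrank_of_injective inj
  rw [Module.finrank_fintype_fun_eq_card, Module.finrank_fintype_fun_eq_card] at this
  unfold MinimalGradedFreeResolution.betti
  rw [Nat.card_eq_fintype_card, Nat.card_eq_fintype_card]
  exact this

theorem bettiNumber_eq (R : MinimalGradedFreeResolution I) (i j : ℕ) :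
    bettiNumber I i j = R.betti i j := by
  have : {b | ∃ R : MinimalGradedFreeResolution I, R.betti i j = b} = {R.betti i j} := by
    ext b
    constructor
    · rintro ⟨R', rfl⟩
      exact le_antisymm (betti_le _ _ _ _) (betti_le _ _ _ _)
    · rintro rfl; exact ⟨R, rfl⟩
  rw [bettiNumber, this, csSup_singleton]

/-- The strands occurring in a resolution. -/
def strands (R : MinimalGradedFreeResolution I) : Set ℕ :=
  {r | ∃ i, ∃ b : R.ι i, R.deg i b = i + r}

theorem reg_eq (R : MinimalGradedFreeResolution I) : reg I = sSup (strands R) := by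
  unfold reg strands
  congr 1
  ext r
  constructor
  · rintro ⟨i, j, h, rfl⟩
    rw [bettiNumber_eq R] at h
    have := R.finite i
    obtain ⟨⟨b, hb⟩⟩ := (Nat.card_ne_zero.1 h).1
    exact ⟨i, b, hb⟩
  · rintro ⟨i, b, hb⟩
    refine ⟨i, _, ?_, rfl⟩
    rw [bettiNumber_eq R]
    have := R.finite i
    exact Nat.card_ne_zero.2 ⟨⟨⟨b, hb⟩⟩, inferInstance⟩

end Comparison

section Existence

/-- A graded submodule of a finite graded free module. -/
structure GStage (K : Type) [Field K] (σ : Type) where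
  κ : Type
  fin : Finite κ
  deg : κ → ℕ
  N : Submodule (MvPolynomial σ K) (κ →₀ MvPolynomial σ K)
  graded : ∀ v ∈ N, ∀ D, gcomp deg D v ∈ N

variable {K : Type} [Field K] {σ : Type}

theorem gcomp_sum_eq {ι : Type} (deg : ι → ℕ) (v : ι →₀ MvPolynomial σ K) :
    ∃ B, ∑ D ∈ Finset.range B, gcomp deg D v = v := by
  classical
  refine ⟨(v.support.sup fun c => deg c + (v c).totalDegree) + 1, ?_⟩
  apply gh_ext
  intro c k
  rw [Finsupp.finsetSum_apply, coeff_sum]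
  simp only [coeff_gcomp]
  rw [Finset.sum_ite_eq]
  split_ifs with h
  · rfl
  · by_contra h0
    apply h
    have hc : c ∈ v.support := by
      rw [Finsupp.mem_support_iff]; intro h1; apply h0; simp [h1]
    have h1 : k.degree ≤ (v c).totalDegree := by
      have := le_totalDegree (p := v c) (s := k) (mem_support_iff.2 (Ne.symm h0))
      exact this
    have h2 := Finset.le_sup (f := fun c => deg c + (v c).totalDegree) hc
    rw [Finset.mem_range]
    omega

theorem GStage.exists_next [Finite σ] (s : GStage K σ) :
    ∃ t : GStage K σ, ∃ d : (t.κ →₀ MvPolynomial σ K) →ₗ[MvPolynomial σ K]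
        (s.κ →₀ MvPolynomial σ K),
      (∀ b, GH s.deg (t.deg b) (d (Finsupp.single b 1))) ∧ LinearMap.range d = s.N ∧
      LinearMap.ker d = t.N ∧ ∀ v ∈ t.N, ∀ b, constantCoeff (v b) = 0 := by
  classical
  have := s.fin
  let H : Set (s.κ →₀ MvPolynomial σ K) := {v | v ∈ s.N ∧ ∃ D, GH s.deg D v}
  have hspan : Submodule.span (MvPolynomial σ K) H = s.N := by
    apply le_antisymm
    · rw [Submodule.span_le]; exact fun v hv => hv.1
    · intro v hv
      obtain ⟨B, hB⟩ := gcomp_sum_eq s.deg v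
      rw [← hB]
      apply Submodule.sum_mem
      intro D _
      exact Submodule.subset_span ⟨s.graded v hv D, D, gcomp_gh _ _ _⟩
  have hfg : (Submodule.span (MvPolynomial σ K) H).FG := IsNoetherian.noetherian _
  have hex : ∃ n : ℕ, ∃ t : Finset (s.κ →₀ MvPolynomial σ K), ↑t ⊆ H ∧
      Submodule.span (MvPolynomial σ K) (t : Set (s.κ →₀ MvPolynomial σ K)) = s.N ∧ t.card = n := by
    obtain ⟨t, ht1, ht2⟩ := (Submodule.fg_span_iff_fg_span_finset_subset H).1 hfg
    exact ⟨_, t, ht1, by rw [← ht2, hspan], rfl⟩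
  obtain ⟨t, htH, htN, htc⟩ := Nat.find_spec hex
  have hmin : ∀ t' : Finset (s.κ →₀ MvPolynomial σ K), ↑t' ⊆ H →
      Submodule.span (MvPolynomial σ K) (t' : Set (s.κ →₀ MvPolynomial σ K)) = s.N →
      t.card ≤ t'.card := by
    intro t' h1 h2
    rw [htc]
    exact Nat.find_min' hex ⟨t', h1, h2, rfl⟩
  choose dg hdg using fun b : t => (htH b.2).2
  let d : (t →₀ MvPolynomial σ K) →ₗ[MvPolynomial σ K] (s.κ →₀ MvPolynomial σ K) :=
    Finsupp.linearCombination _ Subtype.val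
  have hd : ∀ b, GH s.deg (dg b) (d (Finsupp.single b 1)) := by
    intro b
    simpa [d] using hdg b
  have hrange : LinearMap.range d = s.N := by
    rw [Finsupp.range_linearCombination, ← htN]
    congr 1
    simp
  refine ⟨⟨t, inferInstance, dg, LinearMap.ker d, ?_⟩, d, hd, hrange, rfl, ?_⟩
  · intro v hv D
    rw [LinearMap.mem_ker] at hv ⊢
    rw [GH.comp_map hd, hv, gcomp_zero]
  · intro v hv b
    by_contra hb
    change d v = 0 at hv
    set w := gcomp dg (dg b) v with hw
    have hdw : d w = 0 := by rw [hw, GH.comp_map hd, hv, gcomp_zero]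
    have hwb : w b = C (constantCoeff (v b)) := by
      ext k
      rw [hw, coeff_gcomp, coeff_C]
      by_cases hk : 0 = k
      · subst hk; simp [constantCoeff_eq]
      · have : k.degree ≠ 0 := by
          intro h; exact hk ((Finsupp.degree_eq_zero_iff k).1 h).symm
        rw [if_neg hk, if_neg (by omega)]
    have hmem : (b : s.κ →₀ MvPolynomial σ K) ∈
        Submodule.span (MvPolynomial σ K) ((t.erase b : Finset _) : Set (s.κ →₀ MvPolynomial σ K)) := by
      have h1 : ∑ x : t, w x • (x : s.κ →₀ MvPolynomial σ K) = 0 := by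
        rw [← hdw]
        simp only [d]
        rw [Finsupp.linearCombination_apply, Finsupp.sum_fintype]
        simp
      rw [← Finset.add_sum_erase _ _ (Finset.mem_univ b), hwb] at h1
      have h2 : (b : s.κ →₀ MvPolynomial σ K) = - (C (constantCoeff (v b))⁻¹ : MvPolynomial σ K) •
          ∑ x ∈ Finset.univ.erase b, w x • (x : s.κ →₀ MvPolynomial σ K) := by
        have h3 := eq_neg_of_add_eq_zero_right h1
        rw [h3, smul_neg, neg_smul, neg_neg, smul_smul, ← C_mul, inv_mul_cancel₀ hb, C_1, one_smul]
      suffices hh : ∑ x ∈ Finset.univ.erase b, w x • (x : s.κ →₀ MvPolynomial σ K) ∈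
          Submodule.span (MvPolynomial σ K)
            ((t.erase b : Finset _) : Set (s.κ →₀ MvPolynomial σ K)) by
        have h4 := Submodule.smul_mem _ (- (C (constantCoeff (v b))⁻¹ : MvPolynomial σ K)) hh
        rw [← h2] at h4
        exact h4
      apply Submodule.sum_mem
      intro x hx
      apply Submodule.smul_mem
      apply Submodule.subset_span
      simp only [Finset.mem_erase, Finset.coe_erase, Set.mem_sdiff, Finset.mem_coe,
        Set.mem_singleton_iff] at hx ⊢
      exact ⟨x.2, fun h => hx.1 (Subtype.ext h)⟩
    have hlt : (t.erase b).card < t.card := Finset.card_erase_lt_of_mem b.2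
    refine absurd (hmin (t.erase b) ?_ ?_) (not_le.2 hlt)
    · intro x hx
      exact htH (Finset.mem_of_mem_erase hx)
    · apply le_antisymm
      · rw [← htN]
        exact Submodule.span_mono (by simp)
      · rw [← htN, Submodule.span_le]
        intro x hx
        by_cases hxb : x = b
        · rw [hxb]; exact hmem
        · exact Submodule.subset_span (by simp [hxb]; exact hx)

theorem exists_mgfr [Finite σ] (I : Ideal (MvPolynomial σ K))
    (hI : ∀ p ∈ I, ∀ D, homogeneousComponent D p ∈ I) :
    Nonempty (MinimalGradedFreeResolution I) := by
  classical
  let N0 : Submodule (MvPolynomial σ K) (Unit →₀ MvPolynomial σ K) :=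
    Submodule.comap (Finsupp.lapply ()) I
  let s0 : GStage K σ := ⟨Unit, inferInstance, fun _ => 0, N0, by
    intro v hv D
    change gcomp (fun _ => 0) D v () ∈ I
    have e : gcomp (fun _ : Unit => 0) D v () = homogeneousComponent D (v ()) := by
      simp [gcomp]
    rw [e]
    exact hI _ hv _⟩
  choose nx d hd1 hd2 hd3 hd4 using GStage.exists_next (K := K) (σ := σ)
  let s : ℕ → GStage K σ := fun i => Nat.rec s0 (fun _ x => nx x) i
  refine ⟨{ ι := fun i => (s (i + 1)).κ
            finite := fun i => (s (i + 1)).fin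
            deg := fun i => (s (i + 1)).deg
            d := fun i => d (s (i + 1))
            ε := Finsupp.lapply () ∘ₗ d s0
            range_ε := ?_
            exact_ε := ?_
            exact_d := ?_
            homog_ε := ?_
            homog_d := ?_
            minimal := ?_ }⟩
  · rw [LinearMap.range_comp, hd2]
    apply le_antisymm
    · rintro _ ⟨v, hv, rfl⟩
      exact hv
    · intro p hp
      refine ⟨Finsupp.single () p, ?_, by simp⟩
      change (Finsupp.single () p : Unit →₀ MvPolynomial σ K) () ∈ I
      simpa using hp
  · rw [hd2]
    change _ = (nx s0).N
    rw [← hd3]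
    ext v
    rw [LinearMap.mem_ker, LinearMap.mem_ker]
    constructor
    · intro h
      apply Finsupp.ext
      intro x
      exact h
    · intro h
      rw [LinearMap.comp_apply, h, map_zero]
  · intro i
    rw [hd2, hd3]
  · intro b
    have h1 := hd1 s0 b
    rcases (gh_iff _ _ _).1 h1 () with h | h
    · change (d s0 (Finsupp.single b 1) ()).IsHomogeneous _
      rw [h]; exact isHomogeneous_zero _ _ _
    · exact h.2
  · intro i b c
    exact (gh_iff _ _ _).1 (hd1 (s (i + 1)) b) c
  · intro i b c
    refine hd4 (s i) _ ?_ c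
    rw [← hd3]
    have : d (s (i + 1)) (Finsupp.single b 1) ∈ (s (i + 1)).N := by
      rw [← hd2]; exact ⟨_, rfl⟩
    change _ ∈ (nx (s i)).N at this
    rw [← hd3] at this
    exact this

end Existence

section Cone

variable {K : Type} [Field K] {σ : Type}

/-- Splitting of a free module on a triple sum. -/
noncomputable def trip (S : Type) [CommRing S] (α β γ : Type) :
    ((α ⊕ β ⊕ γ) →₀ S) ≃ₗ[S] ((α →₀ S) × (β →₀ S) × (γ →₀ S)) :=
  (Finsupp.sumFinsuppLEquivProdFinsupp S).trans
    (LinearEquiv.prodCongr (LinearEquiv.refl _ _) (Finsupp.sumFinsuppLEquivProdFinsupp S))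

section trip
variable {S : Type} [CommRing S] {α β γ : Type}

theorem trip_symm_1 (t : (α →₀ S) × (β →₀ S) × (γ →₀ S)) (a : α) :
    (trip S α β γ).symm t (Sum.inl a) = t.1 a := by
  simp [trip, LinearEquiv.trans_symm]

theorem trip_symm_2 (t : (α →₀ S) × (β →₀ S) × (γ →₀ S)) (a : β) :
    (trip S α β γ).symm t (Sum.inr (Sum.inl a)) = t.2.1 a := by
  simp [trip, LinearEquiv.trans_symm]

theorem trip_symm_3 (t : (α →₀ S) × (β →₀ S) × (γ →₀ S)) (a : γ) :
    (trip S α β γ).symm t (Sum.inr (Sum.inr a)) = t.2.2 a := by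
  simp [trip, LinearEquiv.trans_symm]

theorem trip_single_1 (a : α) :
    trip S α β γ (Finsupp.single (Sum.inl a) 1) = (Finsupp.single a 1, 0, 0) := by
  rw [← LinearEquiv.eq_symm_apply]
  ext c
  rcases c with c | c | c
  · rw [trip_symm_1]; classical simp [Finsupp.single_apply]
  · rw [trip_symm_2]; simp
  · rw [trip_symm_3]; simp

theorem trip_single_2 (a : β) :
    trip S α β γ (Finsupp.single (Sum.inr (Sum.inl a)) 1) = (0, Finsupp.single a 1, 0) := by
  rw [← LinearEquiv.eq_symm_apply]
  ext c
  rcases c with c | c | c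
  · rw [trip_symm_1]; simp
  · rw [trip_symm_2]; classical simp [Finsupp.single_apply]
  · rw [trip_symm_3]; simp

theorem trip_single_3 (a : γ) :
    trip S α β γ (Finsupp.single (Sum.inr (Sum.inr a)) 1) = (0, 0, Finsupp.single a 1) := by
  rw [← LinearEquiv.eq_symm_apply]
  ext c
  rcases c with c | c | c
  · rw [trip_symm_1]; simp
  · rw [trip_symm_2]; simp
  · rw [trip_symm_3]; classical simp [Finsupp.single_apply]

end trip

theorem gh_trip {α β γ : Type} {da : α → ℕ} {db : β → ℕ} {dc : γ → ℕ} {D : ℕ}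
    {t : (α →₀ MvPolynomial σ K) × (β →₀ MvPolynomial σ K) × (γ →₀ MvPolynomial σ K)}
    (h1 : GH da D t.1) (h2 : GH db D t.2.1) (h3 : GH dc D t.2.2) :
    GH (Sum.elim da (Sum.elim db dc)) D ((trip _ α β γ).symm t) := by
  rintro (c | c | c) k hk
  · rw [trip_symm_1] at hk; exact h1 c k hk
  · rw [trip_symm_2] at hk; exact h2 c k hk
  · rw [trip_symm_3] at hk; exact h3 c k hk

theorem GH.shift {ι : Type} {deg : ι → ℕ} {D : ℕ} {v : ι →₀ MvPolynomial σ K} (h : GH deg D v) :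
    GH (fun c => deg c + 1) (D + 1) v := by
  intro c k hk
  have := h c k hk
  show deg c + 1 + _ = _
  omega

theorem GH.neg {ι : Type} {deg : ι → ℕ} {D : ℕ} {v : ι →₀ MvPolynomial σ K} (h : GH deg D v) :
    GH deg D (-v) := by
  intro c k hk
  exact h c k (by simpa using hk)

theorem GH.X_smul {ι : Type} {deg : ι → ℕ} {D : ℕ} {v : ι →₀ MvPolynomial σ K} (h : GH deg D v)
    (y : σ) : GH deg (D + 1) ((X y : MvPolynomial σ K) • v) := by
  have := h.monomial_smul (Finsupp.single y 1) 1
  simpa [X] using this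

/-- Shifted family. -/
def prevT (ι : ℕ → Type) : ℕ → Type
  | 0 => Empty
  | i + 1 => ι i

/-- Shifted degrees. -/
def prevDeg {ι : ℕ → Type} (deg : ∀ i, ι i → ℕ) : ∀ i, prevT ι i → ℕ
  | 0 => fun x => Empty.elim x
  | i + 1 => deg i

/-- Shifted differential. -/
noncomputable def prevDiff {S : Type} [CommRing S] {ι : ℕ → Type}
    (d : ∀ i, (ι (i + 1) →₀ S) →ₗ[S] (ι i →₀ S)) :
    ∀ i, (ι i →₀ S) →ₗ[S] (prevT ι i →₀ S)
  | 0 => 0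
  | i + 1 => d i

variable {A B C' : Ideal (MvPolynomial σ K)}

theorem cone_exists (RA : MinimalGradedFreeResolution A) (RB : MinimalGradedFreeResolution B)
    (hAB : A ≤ B) (y : σ) (hy : ∀ p, X y * p ∈ A → p ∈ A)
    (hdeg : ∀ i a b, RB.deg i b < RA.deg i a)
    (hC : ∀ p, p ∈ C' ↔ ∃ a ∈ A, ∃ b ∈ B, p = a + X y * b) :
    ∃ R : MinimalGradedFreeResolution C', ∀ i D, (∃ c, R.deg i c = D) ↔
      ((∃ a, RA.deg i a = D) ∨ (∃ b, RB.deg i b + 1 = D) ∨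
        (∃ a : prevT RA.ι i, prevDeg RA.deg i a + 1 = D)) := by
  obtain ⟨f, f0, f1, f2⟩ := mgfr_compare RA RB hAB
  let φ : ∀ i, (RA.ι i →₀ MvPolynomial σ K) →ₗ[MvPolynomial σ K] (RB.ι i →₀ MvPolynomial σ K) :=
    fun i => f (i + 1)
  have φ1 : ∀ i b, GH (RB.deg i) (RA.deg i b) (φ i (Finsupp.single b 1)) := fun i => f1 (i + 1)
  have φ2 : ∀ i v, RB.d i (φ (i + 1) v) = φ i (RA.d i v) := fun i => f2 (i + 1)
  have φ0 : ∀ v, RB.ε (φ 0 v) = RA.ε v := by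
    intro v
    have h := f2 0 v
    rw [f0] at h
    have h' : Finsupp.single () (RB.ε (φ 0 v)) = Finsupp.single () (RA.ε v) := h
    exact Finsupp.single_injective _ h'
  clear_value φ
  clear f2 f1 f0 f
  have φm : ∀ i b c, constantCoeff (φ i (Finsupp.single b 1) c) = 0 := by
    intro i b c
    by_contra h
    have h1 := φ1 i b c 0 h
    have h2 := hdeg i b c
    simp only [map_zero] at h1
    omega
  have Add : ∀ i v, RA.d i (RA.d (i + 1) v) = 0 := by
    intro i v
    have : RA.d (i + 1) v ∈ LinearMap.ker (RA.d i) := by rw [RA.exact_d]; exact ⟨v, rfl⟩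
    exact this
  have Bdd : ∀ i v, RB.d i (RB.d (i + 1) v) = 0 := by
    intro i v
    have : RB.d (i + 1) v ∈ LinearMap.ker (RB.d i) := by rw [RB.exact_d]; exact ⟨v, rfl⟩
    exact this
  have Aed : ∀ v, RA.ε (RA.d 0 v) = 0 := by
    intro v
    have : RA.d 0 v ∈ LinearMap.ker RA.ε := by rw [RA.exact_ε]; exact ⟨v, rfl⟩
    exact this
  have Bed : ∀ v, RB.ε (RB.d 0 v) = 0 := by
    intro v
    have : RB.d 0 v ∈ LinearMap.ker RB.ε := by rw [RB.exact_ε]; exact ⟨v, rfl⟩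
    exact this
  have Aex : ∀ i v, RA.d i v = 0 → ∃ w, RA.d (i + 1) w = v := by
    intro i v h
    have : v ∈ LinearMap.range (RA.d (i + 1)) := by rw [← RA.exact_d]; exact h
    exact this
  have Bex : ∀ i v, RB.d i v = 0 → ∃ w, RB.d (i + 1) w = v := by
    intro i v h
    have : v ∈ LinearMap.range (RB.d (i + 1)) := by rw [← RB.exact_d]; exact h
    exact this
  have Aex0 : ∀ v, RA.ε v = 0 → ∃ w, RA.d 0 w = v := by
    intro v h
    have : v ∈ LinearMap.range (RA.d 0) := by rw [← RA.exact_ε]; exact h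
    exact this
  have Bex0 : ∀ v, RB.ε v = 0 → ∃ w, RB.d 0 w = v := by
    intro v h
    have : v ∈ LinearMap.range (RB.d 0) := by rw [← RB.exact_ε]; exact h
    exact this
  have Arange : ∀ v, RA.ε v ∈ A := fun v => RA.range_ε.le ⟨v, rfl⟩
  have Brange : ∀ v, RB.ε v ∈ B := fun v => RB.range_ε.le ⟨v, rfl⟩
  have Arange' : ∀ p ∈ A, ∃ v, RA.ε v = p := fun p hp => RA.range_ε.ge hp
  have Brange' : ∀ p ∈ B, ∃ v, RB.ε v = p := fun p hp => RB.range_ε.ge hp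
  -- differentials on triples
  let J : ∀ i, (prevT RA.ι (i + 1) →₀ MvPolynomial σ K) ≃ₗ[MvPolynomial σ K]
      (RA.ι i →₀ MvPolynomial σ K) := fun i => LinearEquiv.refl _ _
  let unp : ∀ i, prevT RA.ι (i + 1) → RA.ι i := fun i b => b
  have JP : ∀ i w, J i (prevDiff RA.d (i + 1) w) = RA.d i w := fun i w => rfl
  have Js : ∀ i b, J i (Finsupp.single b 1) = Finsupp.single (unp i b) 1 := fun i b => rfl
  have Jd : ∀ i b, prevDeg RA.deg (i + 1) b = RA.deg i (unp i b) := fun i b => rfl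
  clear_value J unp
  let D1 : ∀ i, ((RA.ι (i + 1) →₀ MvPolynomial σ K) × (RB.ι (i + 1) →₀ MvPolynomial σ K) ×
      (prevT RA.ι (i + 1) →₀ MvPolynomial σ K)) →ₗ[MvPolynomial σ K]
      ((RA.ι i →₀ MvPolynomial σ K) × (RB.ι i →₀ MvPolynomial σ K) ×
      (prevT RA.ι i →₀ MvPolynomial σ K)) := fun i =>
    LinearMap.prod
      (RA.d i ∘ₗ LinearMap.fst _ _ _ + (X y : MvPolynomial σ K) •
        ((J i).toLinearMap ∘ₗ LinearMap.snd _ _ _ ∘ₗ LinearMap.snd _ _ _))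
      (LinearMap.prod
        (RB.d i ∘ₗ LinearMap.fst _ _ _ ∘ₗ LinearMap.snd _ _ _ +
          φ i ∘ₗ ((J i).toLinearMap ∘ₗ LinearMap.snd _ _ _ ∘ₗ LinearMap.snd _ _ _))
        (- (prevDiff RA.d i ∘ₗ ((J i).toLinearMap ∘ₗ LinearMap.snd _ _ _ ∘ₗ LinearMap.snd _ _ _))))
  have D1a : ∀ i a b c, D1 i (a, b, c) =
      (RA.d i a + (X y : MvPolynomial σ K) • J i c, RB.d i b + φ i (J i c),
        - prevDiff RA.d i (J i c)) := by
    intro i a b c; rfl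
  let E1 : ((RA.ι 0 →₀ MvPolynomial σ K) × (RB.ι 0 →₀ MvPolynomial σ K) ×
      (prevT RA.ι 0 →₀ MvPolynomial σ K)) →ₗ[MvPolynomial σ K] MvPolynomial σ K :=
    RA.ε ∘ₗ LinearMap.fst _ _ _ - (X y : MvPolynomial σ K) •
      (RB.ε ∘ₗ LinearMap.fst _ _ _ ∘ₗ LinearMap.snd _ _ _)
  have E1a : ∀ a b c, E1 (a, b, c) = RA.ε a - X y * RB.ε b := by
    intro a b c; rfl
  clear_value D1 E1
  have hsub : Subsingleton (prevT RA.ι 0 →₀ MvPolynomial σ K) := by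
    have : IsEmpty (prevT RA.ι 0) := inferInstanceAs (IsEmpty Empty)
    infer_instance
  have ex0 : ∀ t, E1 t = 0 ↔ ∃ u, D1 0 u = t := by
    rintro ⟨a, b, c⟩
    rw [E1a]
    constructor
    · intro h
      have h' : RA.ε a = X y * RB.ε b := sub_eq_zero.1 h
      have h1 : RB.ε b ∈ A := hy _ (h' ▸ Arange a)
      obtain ⟨w, hw⟩ := Arange' _ h1
      obtain ⟨u, hu⟩ := Aex0 (a - (X y : MvPolynomial σ K) • w) (by
        rw [map_sub, map_smul, hw, h', smul_eq_mul, sub_self])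
      obtain ⟨v, hv⟩ := Bex0 (b - φ 0 w) (by rw [map_sub, φ0, hw, sub_self])
      refine ⟨(u, v, (J 0).symm w), ?_⟩
      rw [D1a, LinearEquiv.apply_symm_apply, hu, hv, sub_add_cancel, sub_add_cancel, Subsingleton.elim (- prevDiff RA.d 0 w) c]
    · rintro ⟨⟨u, v, w⟩, h⟩
      rw [D1a] at h
      obtain ⟨rfl, h⟩ := Prod.ext_iff.1 h
      obtain ⟨rfl, h⟩ := Prod.ext_iff.1 h
      rw [map_add, map_add, map_smul, Aed, Bed, φ0]
      simp
  have exi : ∀ i t, D1 i t = 0 ↔ ∃ u, D1 (i + 1) u = t := by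
    rintro i ⟨a, b, c⟩
    obtain ⟨c, rfl⟩ := (J i).symm.surjective c
    rw [D1a, LinearEquiv.apply_symm_apply]
    constructor
    · intro h
      obtain ⟨h1, h⟩ := Prod.ext_iff.1 h
      obtain ⟨h2, h3⟩ := Prod.ext_iff.1 h
      change RA.d i a + (X y : MvPolynomial σ K) • c = 0 at h1
      change RB.d i b + φ i c = 0 at h2
      change - prevDiff RA.d i c = 0 at h3
      have h3' : ∃ w, RA.d i w = c := by
        cases i with
        | zero =>
          apply Aex0
          have := congrArg RA.ε h1
          rw [map_add, Aed, map_smul, map_zero, zero_add, smul_eq_mul] at this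
          exact (mul_eq_zero.1 this).resolve_left (X_ne_zero y)
        | succ i =>
          apply Aex
          rw [← JP, neg_eq_zero.1 h3, map_zero]
      obtain ⟨w, rfl⟩ := h3'
      obtain ⟨u, hu⟩ := Aex i (a + (X y : MvPolynomial σ K) • w) (by rw [map_add, map_smul, h1])
      obtain ⟨v, hv⟩ := Bex i (b + φ (i + 1) w) (by rw [map_add, φ2, h2])
      refine ⟨(u, v, (J (i + 1)).symm (-w)), ?_⟩
      rw [D1a, LinearEquiv.apply_symm_apply, hu, hv, map_neg, map_neg, neg_neg, ← JP,
        LinearEquiv.symm_apply_apply, smul_neg, add_neg_cancel_right, add_neg_cancel_right]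
    · rintro ⟨⟨u, v, w⟩, h⟩
      obtain ⟨w, rfl⟩ := (J (i + 1)).symm.surjective w
      rw [D1a, LinearEquiv.apply_symm_apply] at h
      obtain ⟨rfl, h⟩ := Prod.ext_iff.1 h
      obtain ⟨rfl, h⟩ := Prod.ext_iff.1 h
      change - prevDiff RA.d (i + 1) w = (J i).symm c at h
      have h' : c = - RA.d i w := by
        rw [← JP, ← map_neg, h, LinearEquiv.apply_symm_apply]
      subst h'
      rw [map_add, map_add, map_smul, Add, Bdd, φ2]
      have : prevDiff RA.d i (- RA.d i w) = 0 := by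
        cases i with
        | zero => exact Subsingleton.elim _ _
        | succ i =>
          apply (J i).injective
          rw [JP, map_neg, Add, neg_zero, map_zero]
      rw [this]
      simp
  have prevGH : ∀ i b, GH (prevDeg RA.deg i) (RA.deg i b) (prevDiff RA.d i (Finsupp.single b 1)) := by
    intro i b
    cases i with
    | zero => exact GH.zero _ _
    | succ i => exact (gh_iff _ _ _).2 (RA.homog_d i b)
  have prevMin : ∀ i b c, constantCoeff (prevDiff RA.d i (Finsupp.single b 1) c) = 0 := by
    intro i b c
    cases i with
    | zero => exact Empty.elim c
    | succ i => exact RA.minimal i b c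
  have AGH : ∀ i b, GH (RA.deg i) (RA.deg (i + 1) b) (RA.d i (Finsupp.single b 1)) :=
    fun i b => (gh_iff _ _ _).2 (RA.homog_d i b)
  have BGH : ∀ i b, GH (RB.deg i) (RB.deg (i + 1) b) (RB.d i (Finsupp.single b 1)) :=
    fun i b => (gh_iff _ _ _).2 (RB.homog_d i b)
  let e := fun i => trip (MvPolynomial σ K) (RA.ι i) (RB.ι i) (prevT RA.ι i)
  let dd : ∀ i, ((RA.ι (i + 1) ⊕ RB.ι (i + 1) ⊕ prevT RA.ι (i + 1)) →₀ MvPolynomial σ K)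
      →ₗ[MvPolynomial σ K] ((RA.ι i ⊕ RB.ι i ⊕ prevT RA.ι i) →₀ MvPolynomial σ K) := fun i =>
    (e i).symm.toLinearMap ∘ₗ D1 i ∘ₗ (e (i + 1)).toLinearMap
  have dda : ∀ i v, dd i v = (e i).symm (D1 i (e (i + 1) v)) := fun i v => rfl
  clear_value dd
  let dg : ∀ i, (RA.ι i ⊕ RB.ι i ⊕ prevT RA.ι i) → ℕ := fun i =>
    Sum.elim (RA.deg i) (Sum.elim (fun b => RB.deg i b + 1) (fun a => prevDeg RA.deg i a + 1))
  refine ⟨{ ι := fun i => RA.ι i ⊕ RB.ι i ⊕ prevT RA.ι i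
            finite := ?_
            deg := dg
            d := dd
            ε := E1 ∘ₗ (e 0).toLinearMap
            range_ε := ?_
            exact_ε := ?_
            exact_d := ?_
            homog_ε := ?_
            homog_d := ?_
            minimal := ?_ }, ?_⟩
  · intro i
    have := RA.finite i
    have := RB.finite i
    have : Finite (prevT RA.ι i) := by
      cases i with
      | zero => exact inferInstanceAs (Finite Empty)
      | succ i => exact RA.finite i
    infer_instance
  · ext p
    rw [hC]
    constructor
    · rintro ⟨v, rfl⟩
      rw [LinearMap.comp_apply]
      obtain ⟨a, b, c⟩ := (e 0).toLinearMap v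
      rw [E1a]
      exact ⟨_, Arange a, - RB.ε b, B.neg_mem (Brange b), by ring⟩
    · rintro ⟨a, ha, b, hb, rfl⟩
      obtain ⟨a, rfl⟩ := Arange' a ha
      obtain ⟨b, rfl⟩ := Brange' b hb
      refine ⟨(e 0).symm (a, -b, 0), ?_⟩
      rw [LinearMap.comp_apply, LinearEquiv.coe_coe, LinearEquiv.apply_symm_apply, E1a, map_neg]
      ring
  · ext v
    rw [LinearMap.mem_ker, LinearMap.comp_apply, LinearEquiv.coe_coe, ex0]
    constructor
    · rintro ⟨u, hu⟩
      exact ⟨(e (0 + 1)).symm u, by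
        rw [dda, LinearEquiv.apply_symm_apply, hu, LinearEquiv.symm_apply_apply]⟩
    · rintro ⟨u, rfl⟩
      exact ⟨e (0 + 1) u, by rw [dda, LinearEquiv.apply_symm_apply]⟩
  · intro i
    ext v
    rw [LinearMap.mem_ker, dda, LinearEquiv.map_eq_zero_iff, exi]
    constructor
    · rintro ⟨u, hu⟩
      exact ⟨(e (i + 1 + 1)).symm u, by
        rw [dda, LinearEquiv.apply_symm_apply, hu, LinearEquiv.symm_apply_apply]⟩
    · rintro ⟨u, rfl⟩
      exact ⟨e (i + 1 + 1) u, by rw [dda, LinearEquiv.apply_symm_apply]⟩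
  · rintro (b | b | b)
    · rw [LinearMap.comp_apply, LinearEquiv.coe_coe, trip_single_1, E1a, map_zero, mul_zero, sub_zero]
      exact RA.homog_ε b
    · rw [LinearMap.comp_apply, LinearEquiv.coe_coe, trip_single_2, E1a, map_zero, zero_sub]
      have := ((isHomogeneous_X K y).mul (RB.homog_ε b)).neg
      rw [add_comm] at this
      exact this
    · exact Empty.elim b
  · intro i b
    rw [← gh_iff, dda]
    rcases b with b | b | b
    · rw [trip_single_1, D1a]
      apply gh_trip
      · simp only [map_zero, smul_zero, add_zero]; exact AGH i b
      · simpa using GH.zero _ _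
      · simpa using GH.zero _ _
    · rw [trip_single_2, D1a]
      apply gh_trip
      · simpa using GH.zero _ _
      · simp only [map_zero, add_zero]; exact (BGH i b).shift
      · simpa using GH.zero _ _
    · have hd : dg (i + 1) (Sum.inr (Sum.inr b)) = RA.deg i (unp i b) + 1 :=
        congrArg (fun x => x + 1) (Jd i b)
      rw [trip_single_3, D1a, Js, map_zero, map_zero, zero_add, zero_add, hd]
      apply gh_trip
      · exact (GH.single (K := K) (σ := σ) (RA.deg i) (unp i b)).X_smul y
      · exact (φ1 i (unp i b)).shift
      · exact (prevGH i (unp i b)).shift.neg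
  · intro i b c
    rw [dda]
    rcases b with b | b | b
    · rw [trip_single_1, D1a]
      rcases c with c | c | c
      · rw [trip_symm_1]; simpa using RA.minimal i b c
      · rw [trip_symm_2]; simp
      · rw [trip_symm_3]; simp
    · rw [trip_single_2, D1a]
      rcases c with c | c | c
      · rw [trip_symm_1]; simp
      · rw [trip_symm_2]; simpa using RB.minimal i b c
      · rw [trip_symm_3]; simp
    · rw [trip_single_3, D1a, Js, map_zero, map_zero, zero_add, zero_add]
      rcases c with c | c | c
      · rw [trip_symm_1, Finsupp.smul_apply, smul_eq_mul, map_mul]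
        simp
      · rw [trip_symm_2]; exact φm i _ c
      · rw [trip_symm_3, Finsupp.neg_apply, map_neg, neg_eq_zero]; exact prevMin i _ c
  · intro i D
    constructor
    · rintro ⟨c | c | c, h⟩
      · exact Or.inl ⟨c, h⟩
      · exact Or.inr (Or.inl ⟨c, h⟩)
      · exact Or.inr (Or.inr ⟨c, h⟩)
    · rintro (⟨c, h⟩ | ⟨c, h⟩ | ⟨c, h⟩)
      · exact ⟨Sum.inl c, h⟩
      · exact ⟨Sum.inr (Sum.inl c), h⟩
      · exact ⟨Sum.inr (Sum.inr c), h⟩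

end Cone

section Final

variable {K : Type} [Field K] {σ : Type}

theorem single_notMem_range {ι κ : Type}
    (d : (ι →₀ MvPolynomial σ K) →ₗ[MvPolynomial σ K] (κ →₀ MvPolynomial σ K))
    (hd : ∀ b c, constantCoeff (d (Finsupp.single b 1) c) = 0) (b : κ) :
    (Finsupp.single b (1 : MvPolynomial σ K)) ∉ LinearMap.range d := by
  rintro ⟨v, hv⟩
  have := cc_map d hd v b
  rw [hv, Finsupp.single_eq_same] at this
  simp at this

theorem eps_coeff {I : Ideal (MvPolynomial σ K)} (R : MinimalGradedFreeResolution I) (b : R.ι 0)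
    (k : σ →₀ ℕ) (h : coeff k (R.ε (Finsupp.single b 1)) ≠ 0) : k.degree = R.deg 0 b := by
  have := (gh_entry (R.ε (Finsupp.single b 1)) 0 (R.deg 0 b)).2
        (Or.inr ⟨Nat.zero_le _, by simpa using R.homog_ε b⟩) k h
  simpa using this

/-- Lower bound on the degrees of generators in a minimal resolution. -/
theorem deg_lower {I : Ideal (MvPolynomial σ K)} (R : MinimalGradedFreeResolution I)
    (h : ∀ p ∈ I, ∀ k, coeff k p ≠ 0 → 2 ≤ k.degree) : ∀ i b, i + 2 ≤ R.deg i b := by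
  intro i
  induction i with
  | zero =>
    intro b
    have h1 : R.ε (Finsupp.single b 1) ≠ 0 := by
      intro h0
      apply single_notMem_range (R.d 0) (R.minimal 0) b
      rw [← R.exact_ε]; exact h0
    obtain ⟨k, hk⟩ := ne_zero_iff.1 h1
    have h2 := eps_coeff R b k hk
    have h3 := h _ (R.range_ε.le ⟨_, rfl⟩) k hk
    omega
  | succ i ih =>
    intro b
    have h1 : R.d i (Finsupp.single b 1) ≠ 0 := by
      intro h0
      apply single_notMem_range (R.d (i + 1)) (R.minimal (i + 1)) b
      rw [← R.exact_d]; exact h0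
    obtain ⟨c, hc⟩ := Finsupp.ne_iff.1 h1
    obtain ⟨k, hk⟩ := ne_zero_iff.1 hc
    have h2 : GH (R.deg i) (R.deg (i + 1) b) (R.d i (Finsupp.single b 1)) :=
      (gh_iff _ _ _).2 (R.homog_d i b)
    have h3 := h2 c k hk
    have h4 := ih c
    have h5 : k.degree ≠ 0 := by
      intro h0
      rw [Finsupp.degree_eq_zero_iff] at h0
      subst h0
      exact hk (R.minimal i b c)
    omega

/-- If `I` is generated in degrees at least two and contains a quadric monomial, the strand two
occurs. -/
theorem two_mem_strands {I : Ideal (MvPolynomial σ K)} (R : MinimalGradedFreeResolution I)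
    (h : ∀ p ∈ I, ∀ k, coeff k p ≠ 0 → 2 ≤ k.degree) (t : σ →₀ ℕ) (ht : t.degree = 2)
    (htI : monomial t (1 : K) ∈ I) : 2 ∈ strands R := by
  classical
  have h1 : monomial t (1 : K) ∈ LinearMap.range R.ε := by rw [R.range_ε]; exact htI
  obtain ⟨v, hv⟩ := h1
  have h2 : GH (R.aug.deg 0) 2 (Finsupp.single () (monomial t (1 : K))) := by
    intro c k hk
    change coeff k ((Finsupp.single () (monomial t (1 : K)) : Unit →₀ MvPolynomial σ K) ()) ≠ 0 at hk
    rw [Finsupp.single_eq_same, coeff_monomial] at hk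
    have : t = k := by
      by_contra h0
      exact hk (if_neg h0)
    subst this
    change 0 + _ = _
    omega
  obtain ⟨w, hw, hw2⟩ := GH.lift (R.aug.homog 0) h2 ⟨v, by
    exact congrArg (fun q => (Finsupp.single () q : Unit →₀ MvPolynomial σ K)) hv⟩
  have hw0 : w ≠ 0 := by
    rintro rfl
    rw [map_zero] at hw2
    have h3 : (monomial t (1 : K)) = 0 := by
      have := congrArg (fun f : Unit →₀ MvPolynomial σ K => f ()) hw2
      exact Finsupp.single_eq_same.symm.trans this.symm
    rw [monomial_eq_zero] at h3
    exact one_ne_zero h3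
  obtain ⟨c, hc⟩ := Finsupp.ne_iff.1 hw0
  obtain ⟨k, hk⟩ := ne_zero_iff.1 hc
  have h4 := hw c k hk
  have h5 := deg_lower R h 0 c
  refine ⟨0, c, ?_⟩
  change R.deg 0 c + _ = _ at h4
  omega

/-- The unit ideal is free of rank one. -/
noncomputable def resTop : MinimalGradedFreeResolution (⊤ : Ideal (MvPolynomial σ K)) where
  ι := fun i => Nat.casesOn i Unit (fun _ => Empty)
  finite := by rintro (_ | i) <;> dsimp <;> infer_instance
  deg := fun _ _ => 0
  d := fun _ => 0
  ε := Finsupp.lapply (R := MvPolynomial σ K) ()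
  range_ε := by
    rw [eq_top_iff]
    rintro p -
    exact ⟨Finsupp.single () p, by simp⟩
  exact_ε := by
    ext v
    constructor
    · intro h
      refine ⟨0, ?_⟩
      rw [map_zero]
      ext c : 1
      exact Eq.symm h
    · rintro ⟨u, rfl⟩
      simp
  exact_d := by
    intro i
    ext v
    constructor
    · intro h
      refine ⟨0, ?_⟩
      rw [map_zero]
      ext c : 1
      exact Empty.elim c
    · rintro ⟨u, rfl⟩
      simp
  homog_ε := by
    intro b
    rw [Finsupp.lapply_apply]
    have : (Finsupp.single b 1 : Unit →₀ MvPolynomial σ K) () = 1 := by cases b; simp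
    erw [this]
    exact isHomogeneous_one _ _
  homog_d := by intro i b c; left; simp
  minimal := by intro i b c; simp

/-- The zero ideal. -/
noncomputable def resBot : MinimalGradedFreeResolution (⊥ : Ideal (MvPolynomial σ K)) where
  ι := fun _ => Empty
  finite := fun _ => inferInstance
  deg := fun _ _ => 0
  d := fun _ => 0
  ε := 0
  range_ε := LinearMap.range_zero
  exact_ε := by ext v; simp [Subsingleton.elim v 0]
  exact_d := by intro i; ext v; simp [Subsingleton.elim v 0]
  homog_ε := fun b => Empty.elim b
  homog_d := fun _ b => Empty.elim b
  minimal := fun _ b => Empty.elim b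

/-- Monomial ideal with given exponents. -/
noncomputable def mi (K : Type) [Field K] {σ : Type} (s : Set (σ →₀ ℕ)) : Ideal (MvPolynomial σ K) :=
  Ideal.span ((fun e => monomial e (1 : K)) '' s)

theorem mem_mi {s : Set (σ →₀ ℕ)} {p : MvPolynomial σ K} :
    p ∈ mi K s ↔ ∀ k, coeff k p ≠ 0 → ∃ t ∈ s, t ≤ k := by
  unfold mi
  rw [mem_ideal_span_monomial_image]
  simp only [mem_support_iff]

theorem mi_nzd {s : Set (σ →₀ ℕ)} (y : σ) (hs : ∀ t ∈ s, t y = 0) (p : MvPolynomial σ K)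
    (h : X y * p ∈ mi K s) : p ∈ mi K s := by
  classical
  rw [mem_mi] at h ⊢
  intro k hk
  obtain ⟨t, ht, htk⟩ := h (Finsupp.single y 1 + k) (by rwa [coeff_X_mul])
  refine ⟨t, ht, fun v => ?_⟩
  have := htk v
  by_cases hv : v = y
  · subst hv; rw [hs t ht]; exact Nat.zero_le _
  · simpa [Finsupp.single_apply, Ne.symm hv] using this

theorem mi_cone (s u : Set (σ →₀ ℕ)) (y : σ) (p : MvPolynomial σ K) :
    p ∈ mi K (s ∪ (fun e => Finsupp.single y 1 + e) '' u) ↔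
      ∃ a ∈ mi K s, ∃ b ∈ mi K u, p = a + X y * b := by
  have : mi K (s ∪ (fun e => Finsupp.single y 1 + e) '' u) =
      mi K s ⊔ Ideal.span {(X y : MvPolynomial σ K)} * mi K u := by
    unfold mi
    rw [Set.image_union, Ideal.span_union, Ideal.span_mul_span', Set.singleton_mul,
      Set.image_image, Set.image_image]
    congr 3
    ext e : 1
    rw [X, monomial_mul, one_mul]
  rw [this, Submodule.mem_sup]
  constructor
  · rintro ⟨a, ha, c, hc, rfl⟩
    obtain ⟨b, hb, rfl⟩ := Ideal.mem_span_singleton_mul.1 hc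
    exact ⟨a, ha, b, hb, rfl⟩
  · rintro ⟨a, ha, b, hb, rfl⟩
    exact ⟨a, ha, _, Ideal.mem_span_singleton_mul.2 ⟨b, hb, rfl⟩, rfl⟩

theorem mi_deg {s : Set (σ →₀ ℕ)} (hs : ∀ t ∈ s, t.degree = 2) :
    ∀ p ∈ mi K s, ∀ k, coeff k p ≠ 0 → 2 ≤ k.degree := by
  intro p hp k hk
  obtain ⟨t, ht, htk⟩ := mem_mi.1 hp k hk
  rw [← hs t ht]
  exact Finsupp.degree_mono htk

theorem mi_homog (s : Set (σ →₀ ℕ)) (p) (hp : p ∈ mi K s) (D : ℕ) :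
    homogeneousComponent D p ∈ mi K s := by
  classical
  rw [mem_mi] at hp ⊢
  intro k hk
  apply hp
  rw [coeff_homogeneousComponent] at hk
  intro h0
  rw [h0] at hk
  simp at hk

/-- Ideals generated by variables have a linear resolution. -/
theorem linear_res (T : Finset σ) :
    ∃ R : MinimalGradedFreeResolution (mi K ((fun v => Finsupp.single v 1) '' (T : Set σ))),
      ∀ i b, R.deg i b = i + 1 := by
  classical
  induction T using Finset.induction_on with
  | empty =>
    have : mi K ((fun v => Finsupp.single v 1) '' ((∅ : Finset σ) : Set σ)) = ⊥ := by
      simp [mi]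
    rw [this]
    exact ⟨resBot, fun i b => Empty.elim b⟩
  | insert y T hy ih =>
    obtain ⟨RA, hA⟩ := ih
    have htop : mi K ({0} : Set (σ →₀ ℕ)) = ⊤ := by
      rw [Ideal.eq_top_iff_one, mem_mi]
      intro k _
      exact ⟨0, rfl, fun _ => Nat.zero_le _⟩
    obtain ⟨R, hR⟩ := cone_exists
      (C' := mi K ((fun v => Finsupp.single v 1) '' ((insert y T : Finset σ) : Set σ)))
      RA (resTop (K := K) (σ := σ)) le_top y
      (mi_nzd y (by
        rintro _ ⟨v, hv, rfl⟩
        have : v ≠ y := by rintro rfl; exact hy hv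
        simp [this]))
      (by intro i a b; rw [hA]; exact Nat.succ_pos _)
      (by
        intro p
        rw [← htop, ← mi_cone, Set.image_singleton, add_zero, Finset.coe_insert,
          Set.image_insert_eq, Set.union_comm, Set.insert_eq])
    refine ⟨R, fun i b => ?_⟩
    rcases (hR i _).1 ⟨b, rfl⟩ with ⟨a, ha⟩ | ⟨c, hc⟩ | ⟨a, ha⟩
    · rw [← ha, hA]
    · rw [← hc]
      cases i with
      | zero => rfl
      | succ i => exact Empty.elim c
    · rw [← ha]
      cases i with
      | zero => exact Empty.elim a
      | succ i => exact congrArg (· + 1) (hA i a)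

/-- One step: adding `y * P`. -/
theorem step_strands {s : Set (σ →₀ ℕ)} (T : Finset σ) (hs : ∀ t ∈ s, t.degree = 2)
    (hne : s.Nonempty) (hsT : ∀ t ∈ s, ∃ v ∈ T, t v ≠ 0) (y : σ) (hy : ∀ t ∈ s, t y = 0)
    (RA : MinimalGradedFreeResolution (mi K s)) :
    ∃ R : MinimalGradedFreeResolution (mi K (s ∪ (fun e => Finsupp.single y 1 + e) ''
      ((fun v => Finsupp.single v 1) '' (T : Set σ)))), strands R = strands RA := by
  classical
  obtain ⟨RB, hB⟩ := linear_res (K := K) T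
  have hdeg := deg_lower RA (mi_deg hs)
  obtain ⟨R, hR⟩ := cone_exists (C' := mi K (s ∪ (fun e => Finsupp.single y 1 + e) ''
      ((fun v => Finsupp.single v 1) '' (T : Set σ)))) RA RB (by
        intro p hp
        rw [mem_mi] at hp ⊢
        intro k hk
        obtain ⟨t, ht, htk⟩ := hp k hk
        obtain ⟨v, hv, hv0⟩ := hsT t ht
        refine ⟨_, ⟨v, hv, rfl⟩, ?_⟩
        rw [Finsupp.single_le_iff]
        have := htk v
        omega) y (mi_nzd y hy)
      (by intro i a b; rw [hB]; have := hdeg i a; omega) (fun p => mi_cone _ _ _ _)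
  have h2 : 2 ∈ strands RA := by
    obtain ⟨t, ht⟩ := hne
    exact two_mem_strands RA (mi_deg hs) t (hs t ht) (Ideal.subset_span ⟨t, ht, rfl⟩)
  refine ⟨R, ?_⟩
  ext r
  constructor
  · rintro ⟨i, c, hc⟩
    rcases (hR i _).1 ⟨c, hc⟩ with ⟨a, ha⟩ | ⟨b, hb⟩ | ⟨a, ha⟩
    · exact ⟨i, a, ha⟩
    · rw [hB] at hb
      have : r = 2 := by omega
      rw [this]; exact h2
    · cases i with
      | zero => exact Empty.elim a
      | succ i =>
        change RA.deg i a + 1 = _ at ha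
        exact ⟨i, a, by omega⟩
  · rintro ⟨i, a, ha⟩
    obtain ⟨c, hc⟩ := (hR i _).2 (Or.inl ⟨a, ha⟩)
    exact ⟨i, c, hc⟩

end Final
/-- for a nonzero squarefree monomial ideal `I` generated in degree 2 in
the variables `x₁,…,xₙ,z₁,…,z_r` with `zᵢzⱼ ∉ I` for all `i ≠ j`, and
`J = I + (xᵢyⱼ)` in `S = K[x,y,z]`, one has `reg I = reg J`. -/
theorem stmt8 (K : Type) [Field K] (n m r : ℕ)
    (I : Ideal (MvPolynomial (Fin n ⊕ Fin m ⊕ Fin r) K)) (hI0 : I ≠ ⊥)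
    (hI : ∃ 𝒮 : Set (Finset (Fin n ⊕ Fin r)), (∀ s ∈ 𝒮, s.card = 2) ∧ I = Ideal.span
      ((fun s : Finset (Fin n ⊕ Fin r) => ∏ i ∈ s,
        (X (Sum.elim Sum.inl (Sum.inr ∘ Sum.inr) i) :
          MvPolynomial (Fin n ⊕ Fin m ⊕ Fin r) K)) '' 𝒮))
    (hz : ∀ i j : Fin r, i ≠ j →
      (X (Sum.inr (Sum.inr i)) * X (Sum.inr (Sum.inr j)) :
        MvPolynomial (Fin n ⊕ Fin m ⊕ Fin r) K) ∉ I)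
    (J : Ideal (MvPolynomial (Fin n ⊕ Fin m ⊕ Fin r) K))
    (hJ : J = I ⊔ Ideal.span {p | ∃ (i : Fin n) (j : Fin m),
      p = X (Sum.inl i) * X (Sum.inr (Sum.inl j))}) :
    reg I = reg J := by
  classical
  obtain ⟨𝒮, hcard, hIS⟩ := hI
  let emb : Fin n ⊕ Fin r → Fin n ⊕ Fin m ⊕ Fin r := Sum.elim Sum.inl (Sum.inr ∘ Sum.inr)
  let ex : Finset (Fin n ⊕ Fin r) → (Fin n ⊕ Fin m ⊕ Fin r →₀ ℕ) :=
    fun s => ∑ i ∈ s, Finsupp.single (emb i) 1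
  have hmon : ∀ s, monomial (ex s) (1 : K) = ∏ i ∈ s, X (emb i) := by
    intro s
    rw [monomial_sum_one]
    rfl
  have hIG : I = mi K (ex '' 𝒮) := by
    rw [hIS]
    unfold mi
    rw [Set.image_image]
    congr 1
    apply Set.image_congr
    intro s _
    exact (hmon s).symm
  have hne : 𝒮.Nonempty := by
    rw [Set.nonempty_iff_ne_empty]
    rintro rfl
    apply hI0
    rw [hIS, Set.image_empty, Ideal.span_empty]
  have hexd : ∀ s ∈ 𝒮, (ex s).degree = 2 := by
    intro s hs
    simp only [ex, map_sum, Finsupp.degree_single, Finset.sum_const, smul_eq_mul, mul_one]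
    exact hcard s hs
  have hexy : ∀ s j, ex s (Sum.inr (Sum.inl j)) = 0 := by
    intro s j
    simp only [ex, Finsupp.finset_sum_apply]
    apply Finset.sum_eq_zero
    rintro (i | i) _ <;> simp [emb]
  have hexx : ∀ s ∈ 𝒮, ∃ i : Fin n, ex s (Sum.inl i) ≠ 0 := by
    intro s hs
    have h1 : ∃ i : Fin n, Sum.inl i ∈ s := by
      by_contra hno
      push Not at hno
      obtain ⟨a, b, hab, rfl⟩ := Finset.card_eq_two.1 (hcard s hs)
      rcases a with a | a
      · exact hno a (by simp)
      rcases b with b | b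
      · exact hno b (by simp)
      apply hz a b (by rintro rfl; exact hab rfl)
      rw [hIS]
      apply Ideal.subset_span
      refine ⟨_, hs, ?_⟩
      simp only []
      rw [Finset.prod_pair hab]
      rfl
    obtain ⟨i, hi⟩ := h1
    refine ⟨i, ?_⟩
    simp only [ex, Finsupp.finset_sum_apply]
    intro h0
    have := Finset.sum_eq_zero_iff.1 h0 _ hi
    simp [emb] at this
  let G : Finset (Fin m) → Set (Fin n ⊕ Fin m ⊕ Fin r →₀ ℕ) := fun U =>
    ex '' 𝒮 ∪ {e | ∃ j ∈ U, ∃ i : Fin n,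
      e = Finsupp.single (Sum.inr (Sum.inl j)) 1 + Finsupp.single (Sum.inl i) 1}
  have hG0 : G ∅ = ex '' 𝒮 := by
    simp [G]
  obtain ⟨R0⟩ := exists_mgfr (mi K (G ∅)) (fun p hp D => mi_homog _ p hp D)
  have key : ∀ U, ∃ R : MinimalGradedFreeResolution (mi K (G U)), strands R = strands R0 := by
    intro U
    induction U using Finset.induction_on with
    | empty => exact ⟨R0, rfl⟩
    | insert j U hj ih =>
      obtain ⟨RA, hA⟩ := ih
      have hGi : G (insert j U) = G U ∪ (fun e => Finsupp.single (Sum.inr (Sum.inl j)) 1 + e) ''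
          ((fun v => Finsupp.single v 1) ''
            (((Finset.univ : Finset (Fin n)).image Sum.inl : Finset (Fin n ⊕ Fin m ⊕ Fin r)) :
              Set (Fin n ⊕ Fin m ⊕ Fin r))) := by
        ext e
        simp only [G, Set.mem_union, Set.mem_setOf_eq, Finset.mem_insert, Set.mem_image,
          Finset.coe_image, Finset.coe_univ, Set.image_univ, Set.mem_range]
        constructor
        · rintro (h | ⟨j', rfl | hj', i, rfl⟩)
          · exact Or.inl (Or.inl h)
          · exact Or.inr ⟨_, ⟨_, ⟨i, rfl⟩, rfl⟩, rfl⟩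
          · exact Or.inl (Or.inr ⟨j', hj', i, rfl⟩)
        · rintro ((h | ⟨j', hj', i, rfl⟩) | ⟨_, ⟨_, ⟨i, rfl⟩, rfl⟩, rfl⟩)
          · exact Or.inl h
          · exact Or.inr ⟨j', Or.inr hj', i, rfl⟩
          · exact Or.inr ⟨j, Or.inl rfl, i, rfl⟩
      rw [hGi]
      obtain ⟨R, hR⟩ := step_strands (K := K) (s := G U)
        ((Finset.univ : Finset (Fin n)).image Sum.inl) (by
          rintro _ (⟨s, hs, rfl⟩ | ⟨j', hj', i, rfl⟩)
          · exact hexd s hs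
          · simp) (by
          obtain ⟨s, hs⟩ := hne
          exact ⟨_, Or.inl ⟨s, hs, rfl⟩⟩) (by
          rintro _ (⟨s, hs, rfl⟩ | ⟨j', hj', i, rfl⟩)
          · obtain ⟨i, hi⟩ := hexx s hs
            exact ⟨Sum.inl i, by simp, hi⟩
          · exact ⟨Sum.inl i, by simp, by simp⟩) (Sum.inr (Sum.inl j)) (by
          rintro _ (⟨s, hs, rfl⟩ | ⟨j', hj', i, rfl⟩)
          · exact hexy s j
          · have : j' ≠ j := by rintro rfl; exact hj hj'
            simp [this]) RA
      exact ⟨R, hR.trans hA⟩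
  have hJG : J = mi K (G Finset.univ) := by
    rw [hJ, hIG]
    unfold mi
    rw [← Ideal.span_union]
    congr 1
    rw [Set.image_union]
    congr 1
    ext p
    constructor
    · rintro ⟨i, j, rfl⟩
      refine ⟨_, ⟨j, Finset.mem_univ _, i, rfl⟩, ?_⟩
      simp only [X, monomial_mul, one_mul, add_comm]
    · rintro ⟨_, ⟨j, _, i, rfl⟩, rfl⟩
      refine ⟨i, j, ?_⟩
      simp only [X, monomial_mul, one_mul, add_comm]
  obtain ⟨R1, hR1⟩ := key Finset.univ
  rw [hJG, reg_eq R1, hR1, ← reg_eq R0, hG0, ← hIG]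
end

section
/- Let G be a graph on [n] with {1,2} ∈ E(G) and such that no vertex i > 2 is adjacent to both 1 and 2, and let I = I(Ḡ) ⊂ S = K[x_1,…,x_n]. Then depth S/(I^∨ + (x_1,x_2)) ≥ depth S/I^∨ − 1. -/
open MvPolynomial

section Helpers

open RingTheory.Sequence

variable {K : Type} [Field K] {n : ℕ}

lemma aux_length_le_supportDim {R : Type} [CommRing R] [IsNoetherianRing R] (rs : List R) :
    ∀ {M : Type} [AddCommGroup M] [Module R M] [Module.Finite R M],
    IsRegular M rs → ((rs.length : ℕ) : WithBot ℕ∞) ≤ Module.supportDim R M := by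
  induction rs with
  | nil =>
    intro M _ _ _ h
    have := h.nontrivial
    have hb := (Module.supportDim_ne_bot_iff_nontrivial R M).mpr this
    rw [← WithBot.coe_unbot _ hb]
    exact WithBot.coe_le_coe.mpr zero_le
  | cons r rs ih =>
    intro M _ _ _ h
    obtain ⟨h1, h2⟩ := (isRegular_cons_iff M r rs).mp h
    have h3 := ih h2
    have h4 : Module.supportDim R (QuotSMulTop r M) + 1 ≤ Module.supportDim R M :=
      Module.supportDim_quotSMulTop_succ_le_of_notMem_minimalPrimes
        (fun _ ↦ h1.notMem_of_mem_minimalPrimes)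
    calc (((r :: rs).length : ℕ) : WithBot ℕ∞) = (rs.length : WithBot ℕ∞) + 1 := by simp
      _ ≤ Module.supportDim R (QuotSMulTop r M) + 1 := by gcongr
      _ ≤ _ := h4

lemma aux_dim : ringKrullDim (MvPolynomial (Fin n) K) = n := by
  rw [MvPolynomial.ringKrullDim_of_isNoetherianRing]
  simp

lemma aux_prod_mem {H : SimpleGraph (Fin n)} {s : Finset (Fin n)}
    (h : (∏ i ∈ s, (X i : MvPolynomial (Fin n) K)) ∈ edgeIdeal K H) :
    ∃ i ∈ s, ∃ j ∈ s, H.Adj i j := by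
  by_contra! hc
  have hle : edgeIdeal K H ≤ RingHom.ker (eval (fun i => if i ∈ s then (1 : K) else 0)) := by
    refine Ideal.span_le.mpr ?_
    rintro p ⟨i, j, hij, rfl⟩
    have := hc i
    have h2 := fun hi => this hi j
    simp only [SetLike.mem_coe, RingHom.mem_ker, map_mul, eval_X]
    by_cases hi : i ∈ s
    · have : j ∉ s := fun hj => h2 hi hj hij
      simp [this]
    · simp [hi]
  have := hle h
  rw [RingHom.mem_ker, map_prod] at this
  rw [Finset.prod_congr rfl (g := fun _ => (1 : K)) (fun i hi => by simp [hi])] at this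
  simp at this

lemma aux_dual_le {H : SimpleGraph (Fin n)} {i j : Fin n} (h : H.Adj i j) :
    alexDual (edgeIdeal K H) ≤ Ideal.span {(X i : MvPolynomial (Fin n) K), X j} := by
  unfold alexDual
  have hne : i ≠ j := h.ne
  refine (iInf₂_le ({i, j} : Finset (Fin n)) ?_).trans ?_
  · rw [Finset.prod_pair hne]
    exact Ideal.subset_span ⟨i, j, h, rfl⟩
  · simp [Set.image_pair]

lemma aux_X_not_dvd {i j : Fin n} (h : i ≠ j) :
    ¬ (X i : MvPolynomial (Fin n) K) ∣ X j := by
  intro hd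
  have := map_dvd (eval (fun k => if k = j then (1 : K) else 0)) hd
  simp [h] at this

lemma aux_prime_ge {H : SimpleGraph (Fin n)} {q : Ideal (MvPolynomial (Fin n) K)}
    (hq : q.IsPrime) (h : alexDual (edgeIdeal K H) ≤ q) :
    ∃ i j, H.Adj i j ∧ X i ∈ q ∧ X j ∈ q := by
  classical
  let T : Finset (Finset (Fin n)) :=
    Finset.univ.filter (fun s => (∏ i ∈ s, (X i : MvPolynomial (Fin n) K)) ∈ edgeIdeal K H)
  have h1 : T.inf (fun s => Ideal.span ((fun i : Fin n => (X i : MvPolynomial (Fin n) K)) '' ↑s))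
      ≤ q := by
    refine le_trans ?_ h
    refine le_iInf₂ fun s hs => ?_
    exact Finset.inf_le (by simp [T, hs])
  obtain ⟨s, hs, hsq⟩ := (Ideal.IsPrime.inf_le' hq).mp h1
  obtain ⟨i, hi, j, hj, hij⟩ := aux_prod_mem (Finset.mem_filter.mp hs).2
  exact ⟨i, j, hij, hsq (Ideal.subset_span ⟨i, hi, rfl⟩), hsq (Ideal.subset_span ⟨j, hj, rfl⟩)⟩

lemma aux_supportDim (H : SimpleGraph (Fin n)) :
    Module.supportDim (MvPolynomial (Fin n) K)
      (MvPolynomial (Fin n) K ⧸ alexDual (edgeIdeal K H)) + 2 ≤ n := by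
  rw [← aux_dim (K := K)]
  set J := alexDual (edgeIdeal K H)
  by_cases hJ : Nontrivial (MvPolynomial (Fin n) K ⧸ J)
  swap
  · have : Subsingleton (MvPolynomial (Fin n) K ⧸ J) := not_nontrivial_iff_subsingleton.mp hJ
    rw [Module.supportDim_eq_bot_of_subsingleton]
    simp
  have : Nonempty (Module.support (MvPolynomial (Fin n) K) (MvPolynomial (Fin n) K ⧸ J)) :=
    Module.nonempty_support_of_nontrivial.to_subtype
  rw [Module.supportDim, Order.krullDim_eq_iSup_length, ringKrullDim,
    Order.krullDim_eq_iSup_length]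
  apply WithBot.coe_le_coe.mpr
  simp only [ENat.iSup_add, iSup_le_iff]
  intro p
  have hp := p.head.2
  rw [Module.mem_support_iff_of_finite, Ideal.annihilator_quotient] at hp
  obtain ⟨i, j, hij, hi, hj⟩ := aux_prime_ge p.head.1.2 hp
  let q : LTSeries (PrimeSpectrum (MvPolynomial (Fin n) K)) :=
    p.map Subtype.val (fun ⦃_ _⦄ lt ↦ lt)
  have hX : (Ideal.span {(X i : MvPolynomial (Fin n) K)}).IsPrime :=
    (Ideal.span_singleton_prime (X_ne_zero i)).mpr X_prime
  let r : PrimeSpectrum (MvPolynomial (Fin n) K) := ⟨_, hX⟩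
  have hr : r < q.head := by
    refine lt_of_le_of_ne ?_ ?_
    · exact (Ideal.span_singleton_le_iff_mem _).mpr hi
    · intro h
      have : X j ∈ r.asIdeal := by rw [h]; exact hj
      exact aux_X_not_dvd hij.ne (Ideal.mem_span_singleton.mp this)
  have hr' : (⊥ : PrimeSpectrum (MvPolynomial (Fin n) K)) < (q.cons r hr).head := by
    rw [RelSeries.head_cons]
    refine bot_lt_iff_ne_bot.mpr fun h => ?_
    have : X i ∈ r.asIdeal := Ideal.mem_span_singleton_self _
    rw [h] at this
    exact X_ne_zero (R := K) i this
  refine le_of_eq_of_le ?_ (le_iSup _ ((q.cons r hr).cons ⊥ hr'))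
  simp [q]
  rfl

/-- substitution killing `a`, `b` and sending everything in `L` to `d`. -/
noncomputable def auxPhi (K : Type) [Field K] {n : ℕ} (a b d : Fin n) (L : List (Fin n)) :
    MvPolynomial (Fin n) K →ₐ[K] MvPolynomial (Fin n) K :=
  aeval (fun i => if i = a ∨ i = b then 0 else if i ∈ L then X d else X i)

lemma auxPhi_X (a b d : Fin n) (L : List (Fin n)) (i : Fin n) :
    auxPhi K a b d L (X i) = if i = a ∨ i = b then 0 else if i ∈ L then X d else X i := by
  simp [auxPhi]

/-- product of all the variables other than `a`, `b`. -/
noncomputable def auxF (K : Type) [Field K] {n : ℕ} (a b : Fin n) : MvPolynomial (Fin n) K :=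
  ∏ c ∈ Finset.univ.filter (fun c => ¬ (c = a ∨ c = b)), X c

lemma aux_sub_mem (φ : MvPolynomial (Fin n) K →ₐ[K] MvPolynomial (Fin n) K)
    (Q : Ideal (MvPolynomial (Fin n) K)) (h : ∀ i, X i - φ (X i) ∈ Q)
    (p : MvPolynomial (Fin n) K) : p - φ p ∈ Q := by
  have : (Ideal.Quotient.mkₐ K Q).comp φ = Ideal.Quotient.mkₐ K Q := by
    refine MvPolynomial.algHom_ext fun i => ?_
    exact (Ideal.Quotient.eq.mpr (h i)).symm
  exact Ideal.Quotient.eq.mp (DFunLike.congr_fun this p).symm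

lemma aux_ker (a b d : Fin n) (L : List (Fin n)) (had : d ≠ a) (hbd : d ≠ b)
    (hL : ∀ c ∈ L, c ≠ a ∧ c ≠ b) (_hdL : d ∉ L) :
    RingHom.ker (auxPhi K a b d L) = Ideal.span {(X a : MvPolynomial (Fin n) K), X b} ⊔
      Ideal.ofList (L.map fun c => (X c - X d : MvPolynomial (Fin n) K)) := by
  apply le_antisymm
  · intro p hp
    have h := aux_sub_mem (auxPhi K a b d L) (Ideal.span {(X a : MvPolynomial (Fin n) K), X b} ⊔
      Ideal.ofList (L.map fun c => (X c - X d : MvPolynomial (Fin n) K))) ?_ p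
    · rw [RingHom.mem_ker] at hp
      rwa [hp, sub_zero] at h
    · intro i
      rw [auxPhi_X]
      split_ifs with h1 h2
      · rw [sub_zero]
        refine Ideal.mem_sup_left (Ideal.subset_span ?_)
        rcases h1 with rfl | rfl <;> simp
      · refine Ideal.mem_sup_right (Ideal.subset_span ?_)
        exact List.mem_map.mpr ⟨i, h2, rfl⟩
      · simp
  · refine sup_le (Ideal.span_le.mpr ?_) (Ideal.span_le.mpr ?_)
    · rintro p (rfl | rfl) <;> simp [auxPhi_X]
    · intro p hp
      obtain ⟨c, hc, rfl⟩ := List.mem_map.mp hp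
      have := hL c hc
      simp [auxPhi_X, this, hc, had, hbd]

lemma aux_F_not_mem (a b d : Fin n) (L : List (Fin n)) :
    auxF K a b ∉ RingHom.ker (auxPhi K a b d L) := by
  rw [RingHom.mem_ker, auxF, map_prod, Finset.prod_eq_zero_iff]
  rintro ⟨c, hc, h⟩
  rw [auxPhi_X, if_neg (Finset.mem_filter.mp hc).2] at h
  split_ifs at h <;> exact X_ne_zero _ h

lemma aux_reg_step {A : Type} [CommRing A] {Q Q' : Ideal A} {f l : A} (hQ : Q.IsPrime)
    (hQ' : Q'.IsPrime) (h : Q' = Q ⊔ Ideal.span {l}) (hl : l ∉ Q) (hf : f ∉ Q')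
    {g : A} (hg : l * g ∈ Q ⊔ Ideal.span {f}) : g ∈ Q ⊔ Ideal.span {f} := by
  obtain ⟨u, hu, v, hv, huv⟩ := Submodule.mem_sup.mp hg
  obtain ⟨w, rfl⟩ := Ideal.mem_span_singleton.mp hv
  have h1 : f * w ∈ Q' := by
    have : f * w = l * g - u := by rw [← huv]; ring
    rw [this, h]
    exact sub_mem (Ideal.mem_sup_right (Ideal.mul_mem_right _ _ (Ideal.mem_span_singleton_self _)))
      (Ideal.mem_sup_left hu)
  have h2 : w ∈ Q' := (hQ'.mem_or_mem h1).resolve_left hf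
  rw [h] at h2
  obtain ⟨u', hu', v', hv', huv'⟩ := Submodule.mem_sup.mp h2
  obtain ⟨w', rfl⟩ := Ideal.mem_span_singleton.mp hv'
  have h3 : l * (g - f * w') ∈ Q := by
    have : l * (g - f * w') = u + f * u' := by
      rw [mul_sub, ← huv, ← huv']; ring
    rw [this]
    exact add_mem hu (Ideal.mul_mem_left _ _ hu')
  have h4 := (hQ.mem_or_mem h3).resolve_left hl
  have : g = (g - f * w') + f * w' := by ring
  rw [this]
  exact add_mem (Ideal.mem_sup_left h4)
    (Ideal.mem_sup_right (Ideal.mul_mem_right _ _ (Ideal.mem_span_singleton_self _)))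

lemma aux_mem_smul {A : Type} [CommRing A] (I B : Ideal A) (g : A) :
    (Submodule.Quotient.mk g : A ⧸ I) ∈ (B • ⊤ : Submodule A (A ⧸ I)) ↔ g ∈ I ⊔ B := by
  have h1 : (B • ⊤ : Submodule A (A ⧸ I)) = Submodule.map (Submodule.mkQ I) B := by
    have : (⊤ : Submodule A (A ⧸ I)) = Submodule.map (Submodule.mkQ I) ⊤ := by
      rw [Submodule.map_top, Submodule.range_mkQ]
    rw [this, ← Submodule.map_smul'']
    simp
  rw [h1, ← Submodule.mkQ_apply, ← Submodule.mem_comap, Submodule.comap_map_mkQ]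

lemma aux_isRegular (a b d : Fin n) (had : d ≠ a) (hbd : d ≠ b) (L : List (Fin n))
    (hnd : L.Nodup) (hL : ∀ c ∈ L, c ≠ a ∧ c ≠ b ∧ c ≠ d) :
    IsRegular (MvPolynomial (Fin n) K ⧸
      (Ideal.span {auxF K a b} ⊔ Ideal.span {(X a : MvPolynomial (Fin n) K), X b}))
      (L.map fun c => (X c - X d : MvPolynomial (Fin n) K)) := by
  have key : ∀ L' : List (Fin n), (∀ c ∈ L', c ∈ L) →
      (Ideal.span {auxF K a b} ⊔ Ideal.span {(X a : MvPolynomial (Fin n) K), X b}) ⊔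
        Ideal.ofList (L'.map fun c => (X c - X d : MvPolynomial (Fin n) K)) =
      RingHom.ker (auxPhi K a b d L') ⊔ Ideal.span {auxF K a b} := by
    intro L' hL'
    rw [aux_ker a b d L' had hbd (fun c hc => ⟨(hL c (hL' c hc)).1, (hL c (hL' c hc)).2.1⟩)
      (fun hc => (hL d (hL' d hc)).2.2 rfl)]
    ac_rfl
  refine ⟨⟨fun i hi => ?_⟩, ?_⟩
  · rw [isSMulRegular_quotient_iff_mem_of_smul_mem]
    intro x
    obtain ⟨g, rfl⟩ := Submodule.Quotient.mk_surjective _ x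
    have hi' : i < L.length := by simpa using hi
    rw [← Submodule.Quotient.mk_smul, aux_mem_smul, aux_mem_smul, ← List.map_take,
      key _ (fun c hc => List.mem_of_mem_take hc), List.getElem_map, smul_eq_mul]
    have hmem : L[i] ∈ L := List.getElem_mem hi'
    have hsub : ∀ c ∈ L.take (i + 1), c ∈ L := fun c hc => List.mem_of_mem_take hc
    have hsub' : ∀ c ∈ L.take i, c ∈ L := fun c hc => List.mem_of_mem_take hc
    refine aux_reg_step (Q' := RingHom.ker (auxPhi K a b d (L.take (i + 1))))
      (RingHom.ker_isPrime _) (RingHom.ker_isPrime _) ?_ ?_ (aux_F_not_mem _ _ _ _)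
    · rw [aux_ker a b d _ had hbd (fun c hc => ⟨(hL c (hsub c hc)).1, (hL c (hsub c hc)).2.1⟩)
        (fun hc => (hL d (hsub d hc)).2.2 rfl),
        aux_ker a b d _ had hbd (fun c hc => ⟨(hL c (hsub' c hc)).1, (hL c (hsub' c hc)).2.1⟩)
        (fun hc => (hL d (hsub' d hc)).2.2 rfl), ← List.take_concat_get' _ _ hi', List.map_append,
        Ideal.ofList_append]
      simp [sup_assoc]
    · have h1 : L[i] ∉ L.take i := by
        intro h
        obtain ⟨j, hj, hji⟩ := List.mem_take_iff_getElem.mp h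
        have := (List.Nodup.getElem_inj_iff hnd).mp hji
        omega
      have h2 : d ∉ L.take i := fun hc => (hL d (hsub' d hc)).2.2 rfl
      obtain ⟨e1, e2, e3⟩ := hL _ hmem
      rw [RingHom.mem_ker, map_sub, auxPhi_X, auxPhi_X]
      simp only [e1, e2, had, hbd, h1, h2, or_self, if_false]
      rw [sub_eq_zero]
      exact fun h => e3 (X_injective h)
  · intro h
    have h1 : (Submodule.Quotient.mk 1 : MvPolynomial (Fin n) K ⧸
      (Ideal.span {auxF K a b} ⊔ Ideal.span {(X a : MvPolynomial (Fin n) K), X b})) ∈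
      (Ideal.ofList (L.map fun c => (X c - X d : MvPolynomial (Fin n) K)) • ⊤ :
        Submodule (MvPolynomial (Fin n) K) _) := by
      rw [← h]; trivial
    rw [aux_mem_smul] at h1
    have hle : (Ideal.span {auxF K a b} ⊔ Ideal.span {(X a : MvPolynomial (Fin n) K), X b}) ⊔
        Ideal.ofList (L.map fun c => (X c - X d : MvPolynomial (Fin n) K)) ≤
        RingHom.ker (constantCoeff (R := K) (σ := Fin n)) := by
      refine sup_le (sup_le (Ideal.span_le.mpr ?_) (Ideal.span_le.mpr ?_)) (Ideal.span_le.mpr ?_)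
      · rintro p rfl
        rw [SetLike.mem_coe, RingHom.mem_ker, auxF, map_prod]
        exact Finset.prod_eq_zero (i := d) (by simp [had, hbd]) (by simp)
      · rintro p (rfl | rfl) <;> simp
      · intro p hp
        obtain ⟨c, hc, rfl⟩ := List.mem_map.mp hp
        simp
    have := hle h1
    simp at this

lemma aux_ideal_eq (G : SimpleGraph (Fin n)) (a b : Fin n) (hab : G.Adj a b)
    (htri : ∀ c : Fin n, c ≠ a → c ≠ b → ¬ (G.Adj a c ∧ G.Adj b c)) :
    alexDual (edgeIdeal K Gᶜ) ⊔ Ideal.span {(X a : MvPolynomial (Fin n) K), X b} =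
      Ideal.span {auxF K a b} ⊔ Ideal.span {(X a : MvPolynomial (Fin n) K), X b} := by
  apply le_antisymm
  · refine sup_le ?_ le_sup_right
    intro p hp
    have hX : ∀ i, auxPhi K a b a [] (X i) = if i = a ∨ i = b then 0 else X i := by
      intro i; simp [auxPhi_X]
    have h1 := aux_sub_mem (auxPhi K a b a []) (Ideal.span {X a, X b}) (by
      intro i
      rw [hX]
      split_ifs with h
      · rw [sub_zero]
        refine Ideal.subset_span ?_
        rcases h with rfl | rfl <;> simp
      · simp) p
    have h2 : ∀ c, c ≠ a → c ≠ b → X c ∣ auxPhi K a b a [] p := by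
      intro c hca hcb
      have aux : ∀ i, (i = a ∨ i = b) → Gᶜ.Adj i c → X c ∣ auxPhi K a b a [] p := by
        intro i hi hic
        have := aux_dual_le (K := K) hic hp
        obtain ⟨u, v, huv⟩ := Ideal.mem_span_pair.mp this
        rw [← huv, map_add, map_mul, map_mul, hX, hX, if_pos hi, if_neg (by tauto)]
        simp
      by_cases hac : G.Adj a c
      · refine aux b (Or.inr rfl) ?_
        rw [SimpleGraph.compl_adj]
        exact ⟨hcb.symm, fun h => htri c hca hcb ⟨hac, h⟩⟩
      · refine aux a (Or.inl rfl) ?_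
        rw [SimpleGraph.compl_adj]
        exact ⟨hca.symm, hac⟩
    have h3 : auxF K a b ∣ auxPhi K a b a [] p := by
      refine Finset.prod_dvd_of_isRelPrime ?_ ?_
      · intro i _ j _ hij
        exact (X_prime.irreducible.isRelPrime_iff_not_dvd).mpr (aux_X_not_dvd hij)
      · intro c hc
        have := (Finset.mem_filter.mp hc).2
        push Not at this
        exact h2 c this.1 this.2
    have : p = auxPhi K a b a [] p + (p - auxPhi K a b a [] p) := by ring
    rw [this]
    exact add_mem (Ideal.mem_sup_left (Ideal.mem_span_singleton.mpr h3)) (Ideal.mem_sup_right h1)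
  · refine sup_le ?_ le_sup_right
    refine le_trans ?_ le_sup_left
    rw [Ideal.span_singleton_le_iff_mem, alexDual]
    simp only [Ideal.mem_iInf]
    intro s hs
    obtain ⟨i, hi, j, hj, hij⟩ := aux_prod_mem hs
    rw [SimpleGraph.compl_adj] at hij
    have : ∃ c ∈ s, ¬ (c = a ∨ c = b) := by
      by_contra! hc
      rcases hc i hi with rfl | rfl <;> rcases hc j hj with rfl | rfl
      · exact hij.1 rfl
      · exact hij.2 hab
      · exact hij.2 hab.symm
      · exact hij.1 rfl
    obtain ⟨c, hc, hc'⟩ := this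
    have hd : X c ∣ auxF K a b := Finset.dvd_prod_of_mem _ (by simpa using hc')
    exact Ideal.mem_of_dvd _ hd (Ideal.subset_span ⟨c, hc, rfl⟩)

end Helpers

/-- if `{a,b} ∈ E(G)` and no other vertex is adjacent to both `a` and
`b`, then for `I = I(Ḡ)`: `depth S/(I^∨ + (x_a, x_b)) ≥ depth S/I^∨ - 1`. -/
theorem stmt12 (K : Type) [Field K] (n : ℕ) (G : SimpleGraph (Fin n)) (a b : Fin n)
    (hab : G.Adj a b)
    (htri : ∀ c : Fin n, c ≠ a → c ≠ b → ¬ (G.Adj a c ∧ G.Adj b c)) :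
    depthIdeal (irrelevantIdeal K (Fin n))
      (MvPolynomial (Fin n) K ⧸
        (alexDual (edgeIdeal K Gᶜ) ⊔
          Ideal.span {(X a : MvPolynomial (Fin n) K), X b})) ≥
    depthIdeal (irrelevantIdeal K (Fin n))
      (MvPolynomial (Fin n) K ⧸ alexDual (edgeIdeal K Gᶜ)) - 1 := by
  set RS := {k | ∃ rs : List (MvPolynomial (Fin n) K), rs.length = k ∧
    (∀ r ∈ rs, r ∈ irrelevantIdeal K (Fin n)) ∧ RingTheory.Sequence.IsRegular
      (MvPolynomial (Fin n) K ⧸ alexDual (edgeIdeal K Gᶜ)) rs} with hRS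
  change sSup RS - 1 ≤ _
  rcases RS.eq_empty_or_nonempty with he | hne
  · rw [he]; simp
  have hbd : ∀ k ∈ RS, k + 2 ≤ n := by
    rintro k ⟨rs, rfl, -, hreg⟩
    have h1 := aux_length_le_supportDim rs hreg
    have h2 := aux_supportDim (K := K) Gᶜ
    have h3 : ((rs.length + 2 : ℕ) : WithBot ℕ∞) ≤ (n : ℕ) := by
      refine le_trans ?_ h2
      push_cast
      gcongr
    exact_mod_cast h3
  have hsup : sSup RS + 2 ≤ n := by
    have : sSup RS ≤ n - 2 := csSup_le hne fun k hk => by have := hbd k hk; omega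
    obtain ⟨k, hk⟩ := hne
    have := hbd k hk
    omega
  -- a non-edge exists, hence a third vertex
  obtain ⟨d, hda, hdb⟩ : ∃ d, d ≠ a ∧ d ≠ b := by
    by_contra! hc
    obtain ⟨k, rs, -, -, hreg⟩ := hne
    have hnt := hreg.nontrivial
    have hJ : alexDual (edgeIdeal K Gᶜ) ≠ ⊤ := Ideal.Quotient.nontrivial_iff.mp hnt
    obtain ⟨q, hq, hle⟩ := Ideal.exists_le_maximal _ hJ
    obtain ⟨i, j, hij, -, -⟩ := aux_prime_ge hq.isPrime hle
    rw [SimpleGraph.compl_adj] at hij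
    have key : ∀ c, c = a ∨ c = b := fun c => by
      by_cases h : c = a
      · exact Or.inl h
      · exact Or.inr (hc c h)
    rcases key i with rfl | rfl <;> rcases key j with rfl | rfl
    · exact hij.1 rfl
    · exact hij.2 hab
    · exact hij.2 hab.symm
    · exact hij.1 rfl
  rw [aux_ideal_eq G a b hab htri]
  let L : List (Fin n) := (Finset.univ \ {a, b, d}).toList
  have hlen : L.length = n - 3 := by
    rw [Finset.length_toList, Finset.card_sdiff_of_subset (Finset.subset_univ _)]
    rw [Finset.card_univ, Fintype.card_fin, Finset.card_eq_three.mpr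
      ⟨a, b, d, hab.ne, hda.symm, hdb.symm, rfl⟩]
  have hreg := aux_isRegular (K := K) a b d hda hdb L (Finset.nodup_toList _) (by
    intro c hc
    simpa [L] using hc)
  have hle : n - 3 ≤ depthIdeal (irrelevantIdeal K (Fin n)) (MvPolynomial (Fin n) K ⧸
      (Ideal.span {auxF K a b} ⊔ Ideal.span {(X a : MvPolynomial (Fin n) K), X b})) := by
    refine le_csSup ⟨n, ?_⟩ ⟨_, by rw [List.length_map, hlen], ?_, hreg⟩
    · rintro k ⟨rs, rfl, -, hr⟩
      have h1 := (aux_length_le_supportDim rs hr).trans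
        (Module.supportDim_le_ringKrullDim _ _)
      rw [aux_dim] at h1
      exact_mod_cast h1
    · intro r hr
      obtain ⟨c, -, rfl⟩ := List.mem_map.mp hr
      exact sub_mem (Ideal.subset_span ⟨c, rfl⟩) (Ideal.subset_span ⟨d, rfl⟩)
  omega
end
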